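/- arXiv:math/0203226 — 4 statements merged into one kernel-verified Lean document; each statement's English description precedes it below -/
import Mathlib

section
/- Let s and t be positive integers and let α_{s,t} be the permutation of {1,…,s+t+1} whose one-line notation is s+1, s+2, …, s+t+1, s, s−1, …, 2, 1. Then for all n ≥ 1, |S_n(132, 213, α_{s,t})| = Σ_{k=1}^{s−1} C(n−1, k−1) + Σ_{k=s}^{n} C(k−1, s−1)·F_{t, n−k+1}, where C(a,b) denotes the binomial coefficient. -/
/-- `π` contains `σ` as a pattern: there is a subsequence of `π` (in one-line notation)
whose entries are in the same relative order as those of `σ`. -/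
def PContains {n k : ℕ} (π : Equiv.Perm (Fin n)) (σ : Equiv.Perm (Fin k)) : Prop :=
  ∃ f : Fin k → Fin n, StrictMono f ∧ ∀ s t : Fin k, π (f s) < π (f t) ↔ σ s < σ t

/-- `π` avoids the pattern `σ`. -/
def PAvoids {n k : ℕ} (π : Equiv.Perm (Fin n)) (σ : Equiv.Perm (Fin k)) : Prop :=
  ¬ PContains π σ

/-- The k-generalized Fibonacci numbers: `genFib k n = F_{k,n}`, with
`F_{k,n} = 0` for `n ≤ 0`, `F_{k,1} = 1`, and `F_{k,n} = ∑_{i=1}^k F_{k,n-i}` for `n ≥ 2`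
(terms with nonpositive index being `0`). -/
def genFib (k : ℕ) : ℕ → ℕ
  | 0 => 0
  | 1 => 1
  | n + 2 => ∑ i ∈ Finset.range k, genFib k (n + 1 - i)
decreasing_by omega

/-- The pattern 132 (one-line notation `1,3,2`, zero-indexed `0,2,1`). -/
noncomputable def p132 : Equiv.Perm (Fin 3) := Equiv.ofBijective ![0, 2, 1] (by decide)

/-- The pattern 213 (one-line notation `2,1,3`, zero-indexed `1,0,2`). -/
noncomputable def p213 : Equiv.Perm (Fin 3) := Equiv.ofBijective ![1, 0, 2] (by decide)

open Finset in
/-- A word, given by the set `A` of positions below `m` carrying its first letter, has a run of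
length `t` in `A` after which at least `s` positions outside `A` occur. -/
def HasRunBefore (t s m : ℕ) (A : Finset ℕ) : Prop :=
  ∃ i, i + t ≤ m ∧ (∀ j, i ≤ j → j < i + t → j ∈ A) ∧ s ≤ #(Ico (i + t) m \ A)

/-- The set `A`, extended by the `r` positions following `m`, has a run of length `t`. -/
def HasRunExt (t m r : ℕ) (A : Finset ℕ) : Prop :=
  ∃ i, i + t ≤ m + r ∧ ∀ j, i ≤ j → j < i + t → j < m → j ∈ A

/-- The permutation `π` is layered with ascent set `A`. -/
def IsLayeredBy {n : ℕ} (π : Equiv.Perm (Fin n)) (A : Finset ℕ) : Prop :=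
  ∀ p q : Fin n, p < q → (π p < π q ↔ ∀ k, (p : ℕ) ≤ k → k < q → k ∈ A)

open Finset in
theorem card_filter_powerset_range_succ (P : Finset ℕ → Prop) [DecidablePred P] (m : ℕ) :
    #{A ∈ (range (m + 1)).powerset | P A} =
      #{A ∈ (range m).powerset | P A} + #{A ∈ (range m).powerset | P (insert m A)} := by
  have hm : m ∉ range m := by simp
  rw [range_add_one, powerset_insert, filter_union, card_union_of_disjoint, filter_image,
    card_image_of_injOn]
  · intro A hA B hB h
    simp only [coe_filter, mem_powerset, Set.mem_ofPred_eq] at hA hB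
    have hA' : m ∉ A := fun h' => hm (hA.1 h')
    have hB' : m ∉ B := fun h' => hm (hB.1 h')
    rw [← erase_insert hA', ← erase_insert hB']
    exact congrArg (·.erase m) h
  · rw [disjoint_left]
    intro A hA hA'
    simp only [mem_filter, mem_powerset, mem_image] at hA hA'
    obtain ⟨⟨B, -, rfl⟩, -⟩ := hA'
    exact hm (hA.1 (mem_insert_self m B))

theorem hasRunExt_succ_of_notMem {t m r : ℕ} {A : Finset ℕ} (hr : r < t) (hA : m ∉ A) :
    HasRunExt t (m + 1) r A ↔ HasRunExt t m 0 A := by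
  constructor
  · rintro ⟨i, hi, h⟩
    have : i + t ≤ m := by
      by_contra hlt
      exact hA (h m (by omega) (by omega) (by omega))
    exact ⟨i, by omega, fun j h1 h2 h3 => h j h1 h2 (by omega)⟩
  · rintro ⟨i, hi, h⟩
    exact ⟨i, by omega, fun j h1 h2 h3 => h j h1 h2 (by omega)⟩

theorem hasRunExt_succ_insert {t m r : ℕ} {A : Finset ℕ} :
    HasRunExt t (m + 1) r (insert m A) ↔ HasRunExt t m (r + 1) A := by
  constructor
  · rintro ⟨i, hi, h⟩
    refine ⟨i, by omega, fun j h1 h2 h3 => ?_⟩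
    exact Finset.mem_of_mem_insert_of_ne (h j h1 h2 (by omega)) (by omega)
  · rintro ⟨i, hi, h⟩
    refine ⟨i, by omega, fun j h1 h2 h3 => ?_⟩
    rcases eq_or_ne j m with rfl | hj
    · exact Finset.mem_insert_self _ _
    · exact Finset.mem_insert_of_mem (h j h1 h2 (by omega))

theorem genFib_add_two (t m : ℕ) :
    genFib t (m + 2) = ∑ i ∈ Finset.range t, genFib t (m + 1 - i) := by
  rw [genFib]

open Finset Classical in
theorem card_not_hasRunExt (t m r : ℕ) (hr : r ≤ t) :
    #{A ∈ (range m).powerset | ¬ HasRunExt t m r A} =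
      ∑ i ∈ range (t - r), genFib t (m + 1 - i) := by
  induction m generalizing r with
  | zero =>
    have h0 : HasRunExt t 0 r ∅ ↔ t ≤ r :=
      ⟨fun ⟨i, hi, _⟩ => by omega, fun h => ⟨0, by omega, fun _ _ _ h => by omega⟩⟩
    rw [range_zero, powerset_empty, filter_singleton, h0]
    rcases hr.eq_or_lt with rfl | hlt
    · simp
    · obtain ⟨d, hd⟩ : ∃ d, t - r = d + 1 := ⟨t - r - 1, by omega⟩
      rw [hd, sum_range_succ']
      simp [genFib, hlt]
  | succ m ih =>
    rcases hr.eq_or_lt with rfl | hlt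
    · rw [Nat.sub_self, range_zero, sum_empty, card_eq_zero, filter_eq_empty_iff]
      exact fun A _ h => h ⟨m + 1, by omega, fun _ _ _ h => by omega⟩
    · rw [card_filter_powerset_range_succ]
      obtain ⟨d, hd⟩ : ∃ d, t - r = d + 1 := ⟨t - r - 1, by omega⟩
      have h1 : #{A ∈ (range m).powerset | ¬ HasRunExt t (m + 1) r A} = genFib t (m + 2) := by
        have ih0 := ih 0 (Nat.zero_le _)
        rw [Nat.sub_zero] at ih0
        rw [genFib_add_two, ← ih0]
        congr 1
        refine filter_congr fun A hA => not_congr (hasRunExt_succ_of_notMem hlt ?_)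
        exact fun h => by simpa using mem_powerset.1 hA h
      rw [h1, hd, sum_range_succ', add_comm]
      simp only [hasRunExt_succ_insert]
      rw [ih (r + 1) hlt, show t - (r + 1) = d by omega]
      simp

theorem hasRunBefore_zero_iff {t m : ℕ} {A : Finset ℕ} :
    HasRunBefore t 0 m A ↔ HasRunExt t m 0 A :=
  ⟨fun ⟨i, hi, h, _⟩ => ⟨i, hi, fun j h1 h2 _ => h j h1 h2⟩,
    fun ⟨i, hi, h⟩ => ⟨i, hi, fun j h1 h2 => h j h1 h2 (by omega), Nat.zero_le _⟩⟩

theorem hasRunBefore_succ_of_notMem {t s m : ℕ} {A : Finset ℕ} (ht : 1 ≤ t) (hA : m ∉ A) :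
    HasRunBefore t (s + 1) (m + 1) A ↔ HasRunBefore t s m A := by
  have key : ∀ i, i + t ≤ m → Finset.card (Finset.Ico (i + t) (m + 1) \ A) =
      Finset.card (Finset.Ico (i + t) m \ A) + 1 := by
    intro i hi
    rw [← Finset.insert_Ico_right_eq_Ico_add_one hi, Finset.insert_sdiff_of_notMem _ hA,
      Finset.card_insert_of_notMem (by simp)]
  constructor
  · rintro ⟨i, hi, h, hc⟩
    have him : i + t ≤ m := by
      by_contra hlt
      exact hA (h m (by omega) (by omega))
    rw [key i him] at hc
    exact ⟨i, him, h, by omega⟩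
  · rintro ⟨i, hi, h, hc⟩
    exact ⟨i, by omega, h, by rw [key i hi]; omega⟩

theorem hasRunBefore_succ_insert {t s m : ℕ} {A : Finset ℕ} :
    HasRunBefore t (s + 1) (m + 1) (insert m A) ↔ HasRunBefore t (s + 1) m A := by
  have key : ∀ i, i + t ≤ m → Finset.Ico (i + t) (m + 1) \ insert m A =
      Finset.Ico (i + t) m \ A := by
    intro i hi
    ext k
    simp only [Finset.mem_sdiff, Finset.mem_Ico, Finset.mem_insert]
    grind
  constructor
  · rintro ⟨i, hi, h, hc⟩
    have him : i + t ≤ m := by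
      by_contra hlt
      rw [Finset.Ico_eq_empty (by omega)] at hc
      simp at hc
    rw [key i him] at hc
    exact ⟨i, him, fun j h1 h2 => Finset.mem_of_mem_insert_of_ne (h j h1 h2) (by omega), hc⟩
  · rintro ⟨i, hi, h, hc⟩
    exact ⟨i, by omega, fun j h1 h2 => Finset.mem_insert_of_mem (h j h1 h2), by rwa [key i hi]⟩

open Finset Classical in
theorem card_not_hasRunBefore (t s m : ℕ) (ht : 1 ≤ t) :
    #{A ∈ (range m).powerset | ¬ HasRunBefore t (s + 1) m A} =
      ∑ i ∈ range s, m.choose i + ∑ j ∈ range (m + 1), j.choose s * genFib t (m + 1 - j) := by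
  induction m generalizing s with
  | zero =>
    have h0 : ¬ HasRunBefore t (s + 1) 0 ∅ := fun ⟨i, hi, _⟩ => by omega
    rw [range_zero, powerset_empty, filter_singleton, if_pos h0]
    cases s with
    | zero => simp [genFib]
    | succ s => simp [sum_range_succ']
  | succ m ih =>
    have h1 : #{A ∈ (range m).powerset | ¬ HasRunBefore t (s + 1) (m + 1) A} =
        #{A ∈ (range m).powerset | ¬ HasRunBefore t s m A} := by
      congr 1
      refine filter_congr fun A hA => not_congr (hasRunBefore_succ_of_notMem ht ?_)
      exact fun h => by simpa using mem_powerset.1 hA h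
    rw [card_filter_powerset_range_succ, h1]
    simp only [hasRunBefore_succ_insert]
    rw [ih, sum_range_succ' _ (m + 1)]
    cases s with
    | zero =>
      simp only [hasRunBefore_zero_iff]
      rw [card_not_hasRunExt t m 0 (Nat.zero_le _), Nat.sub_zero, ← genFib_add_two]
      simp
      ring
    | succ s =>
      rw [ih, sum_range_succ' _ s, sum_range_succ' _ s]
      simp only [Nat.choose_succ_succ, add_mul, sum_add_distrib, Nat.add_sub_add_right]
      simp
      ring

theorem pContains_p132_iff {n : ℕ} {π : Equiv.Perm (Fin n)} :
    PContains π p132 ↔ ∃ a b c, a < b ∧ b < c ∧ π a < π c ∧ π c < π b := by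
  constructor
  · rintro ⟨f, hf, h⟩
    exact ⟨f 0, f 1, f 2, hf (by decide), hf (by decide),
      (h 0 2).2 (by simp [p132]), (h 2 1).2 (by simp [p132])⟩
  · rintro ⟨a, b, c, hab, hbc, h1, h2⟩
    refine ⟨![a, b, c], ?_, ?_⟩
    · rw [Fin.strictMono_iff_lt_succ]
      intro i
      fin_cases i <;> simpa
    · intro i j
      fin_cases i <;> fin_cases j <;> simp [p132] <;> order

theorem pContains_p213_iff {n : ℕ} {π : Equiv.Perm (Fin n)} :
    PContains π p213 ↔ ∃ a b c, a < b ∧ b < c ∧ π b < π a ∧ π a < π c := by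
  constructor
  · rintro ⟨f, hf, h⟩
    exact ⟨f 0, f 1, f 2, hf (by decide), hf (by decide),
      (h 1 0).2 (by simp [p213]), (h 0 2).2 (by simp [p213])⟩
  · rintro ⟨a, b, c, hab, hbc, h1, h2⟩
    refine ⟨![a, b, c], ?_, ?_⟩
    · rw [Fin.strictMono_iff_lt_succ]
      intro i
      fin_cases i <;> simpa
    · intro i j
      fin_cases i <;> fin_cases j <;> simp [p213] <;> order

open Finset Classical in
/-- The set of ascents of a permutation. -/
noncomputable def ascentSet {m : ℕ} (π : Equiv.Perm (Fin (m + 1))) : Finset ℕ :=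
  {k ∈ range m | ∃ a b : Fin (m + 1), (a : ℕ) = k ∧ (b : ℕ) = k + 1 ∧ π a < π b}

theorem mem_ascentSet_iff {m : ℕ} {π : Equiv.Perm (Fin (m + 1))} {a b : Fin (m + 1)}
    (hab : (b : ℕ) = a + 1) : (a : ℕ) ∈ ascentSet π ↔ π a < π b := by
  simp only [ascentSet, Finset.mem_filter, Finset.mem_range]
  constructor
  · rintro ⟨-, a', b', ha, hb, h⟩
    rwa [Fin.ext ha, Fin.ext (hb.trans hab.symm)] at h
  · exact fun h => ⟨by omega, a, b, rfl, hab, h⟩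

theorem isLayeredBy_ascentSet {m : ℕ} {π : Equiv.Perm (Fin (m + 1))}
    (h1 : PAvoids π p132) (h2 : PAvoids π p213) : IsLayeredBy π (ascentSet π) := by
  rw [PAvoids, pContains_p132_iff] at h1
  rw [PAvoids, pContains_p213_iff] at h2
  push Not at h1 h2
  intro p q hpq
  constructor
  · intro hlt k hpk hkq
    let a : Fin (m + 1) := ⟨k, by omega⟩
    let b : Fin (m + 1) := ⟨k + 1, by omega⟩
    rw [show k = (a : ℕ) from rfl, mem_ascentSet_iff (b := b) rfl]
    by_contra hba
    have hab : a < b := Fin.mk_lt_mk.2 (by omega)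
    have hba : π b < π a := lt_of_le_of_ne (not_lt.1 hba) (π.injective.ne hab.ne')
    have hpa : p ≤ a := hpk
    have hbq : b ≤ q := Fin.mk_le_of_le_val hkq
    rcases hpa.eq_or_lt with hpa | hpa
    · rcases hbq.eq_or_lt with hbq | hbq
      · rw [hpa, ← hbq] at hlt; order
      · have := h2 a b q hab hbq hba
        rw [hpa] at hlt; order
    · rcases hbq.eq_or_lt with hbq | hbq
      · have := h1 p a b hpa hab (hbq ▸ hlt); order
      · have e1 := h1 p a b hpa hab
        have e2 := h2 a b q hab hbq hba
        have e3 := h1 p a q hpa (hab.trans hbq) hlt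
        have := π.injective.ne (hab.trans hbq).ne
        order
  · intro h
    obtain ⟨d, hd⟩ : ∃ d, (q : ℕ) = p + d + 1 := ⟨q - p - 1, by omega⟩
    clear hpq
    induction d generalizing q with
    | zero => exact (mem_ascentSet_iff hd).1 (h p le_rfl (by omega))
    | succ d ih =>
      let b : Fin (m + 1) := ⟨p + d + 1, by omega⟩
      have hb : (b : ℕ) = p + d + 1 := rfl
      refine (ih b (fun k hk hk' => h k hk (by omega)) hb).trans ?_
      exact (mem_ascentSet_iff (by omega)).1 (h b (by omega) (by omega))

namespace IsLayeredBy

variable {n : ℕ} {π : Equiv.Perm (Fin n)} {A : Finset ℕ}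

theorem pAvoids_p132 (h : IsLayeredBy π A) : PAvoids π p132 := by
  rw [PAvoids, pContains_p132_iff]
  rintro ⟨a, b, c, hab, hbc, h1, h2⟩
  have h3 := (h a c (hab.trans hbc)).1 h1
  exact h2.asymm ((h b c hbc).2 fun k hk hk' => h3 k (by omega) hk')

theorem pAvoids_p213 (h : IsLayeredBy π A) : PAvoids π p213 := by
  rw [PAvoids, pContains_p213_iff]
  rintro ⟨a, b, c, hab, hbc, h1, h2⟩
  have h3 := (h a c (hab.trans hbc)).1 h2
  exact h1.asymm ((h a b hab).2 fun k hk hk' => h3 k hk (by omega))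

theorem eq_of_isLayeredBy {π' : Equiv.Perm (Fin n)} (h : IsLayeredBy π A)
    (h' : IsLayeredBy π' A) : π = π' := by
  have key : ∀ p q, π p < π q ↔ π' p < π' q := by
    intro p q
    rcases lt_trichotomy p q with hpq | rfl | hpq
    · rw [h p q hpq, h' p q hpq]
    · simp
    · have e : π q < π p ↔ π' q < π' p := by rw [h q p hpq, h' q p hpq]
      have := π.injective.ne hpq.ne
      have := π'.injective.ne hpq.ne
      grind
  have hmono : StrictMono (π.symm.trans π') := by
    intro a b hab
    simpa using (key (π.symm a) (π.symm b)).1 (by simpa)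
  have heq := Subsingleton.elim (hmono.orderIsoOfSurjective _ (Equiv.surjective _))
    (OrderIso.refl (Fin n))
  ext p
  have := congrArg (fun e => e (π p)) heq
  simpa using congrArg Fin.val this.symm

open Finset in
theorem pContains_iff {m s t : ℕ} {π : Equiv.Perm (Fin (m + 1))} {A : Finset ℕ}
    (h : IsLayeredBy π A) (hs : 1 ≤ s) (ht : 1 ≤ t) {α : Equiv.Perm (Fin (s + t + 1))}
    (hα : ∀ i : Fin (s + t + 1),
      (α i : ℕ) = if (i : ℕ) ≤ t then s + (i : ℕ) else s + t - (i : ℕ)) :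
    PContains π α ↔ HasRunBefore t s m A := by
  constructor
  · rintro ⟨f, hf, hπ⟩
    have hle : ∀ j (hj : j ≤ t), (f ⟨0, by omega⟩ : ℕ) + j ≤ f ⟨j, by omega⟩ := by
      intro j hj
      induction j with
      | zero => simp
      | succ j ih =>
        have := ih (by omega)
        have h1 : f ⟨j, by omega⟩ < f ⟨j + 1, by omega⟩ := hf (by simp)
        rw [Fin.lt_def] at h1
        omega
    have hcard : ∀ j (hj : j ≤ s),
        j ≤ #(Ico (f ⟨t, by omega⟩ : ℕ) (f ⟨t + j, by omega⟩) \ A) := by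
      intro j hj
      induction j with
      | zero => simp
      | succ j ih =>
        have h1 : f ⟨t + j, by omega⟩ < f ⟨t + (j + 1), by omega⟩ := hf (by simp)
        have h0 : f ⟨t, by omega⟩ ≤ f ⟨t + j, by omega⟩ := hf.monotone (by simp)
        have h2 : ¬ π (f ⟨t + j, by omega⟩) < π (f ⟨t + (j + 1), by omega⟩) := by
          rw [hπ, Fin.lt_def, hα, hα]
          simp only
          split_ifs <;> omega
        rw [h _ _ h1] at h2
        push Not at h2
        obtain ⟨k, hk1, hk2, hk3⟩ := h2
        refine (Nat.succ_le_succ (ih (by omega))).trans ?_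
        rw [Nat.succ_eq_add_one, ← card_insert_of_notMem (a := k) (by simp; omega)]
        refine card_le_card fun x hx => ?_
        rw [Fin.lt_def] at h1
        rw [Fin.le_def] at h0
        simp only [mem_insert, mem_sdiff, mem_Ico] at hx ⊢
        rcases hx with rfl | hx
        · exact ⟨by omega, hk3⟩
        · exact ⟨by omega, hx.2⟩
    have h0t : f ⟨0, by omega⟩ < f ⟨t, by omega⟩ := hf (Fin.mk_lt_mk.2 (by omega))
    have hrun := (h _ _ h0t).1 (by
      rw [hπ, Fin.lt_def, hα, hα]
      simp only
      split_ifs <;> omega)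
    have hle := hle t le_rfl
    refine ⟨f ⟨t, by omega⟩ - t, by omega, fun j h1 h2 => hrun j (by omega) (by omega), ?_⟩
    rw [Nat.sub_add_cancel (by omega)]
    refine (hcard s le_rfl).trans (card_le_card (sdiff_subset_sdiff (Ico_subset_Ico_right ?_)
      subset_rfl))
    omega
  · rintro ⟨i, hi, hrun, hc⟩
    obtain ⟨D, hD, hDs⟩ := exists_subset_card_eq hc
    let d := D.orderEmbOfFin hDs
    have hd : ∀ j, (i + t ≤ d j ∧ d j < m) ∧ d j ∉ A := fun j => by
      simpa using hD (D.orderEmbOfFin_mem hDs j)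
    let f : Fin (s + t + 1) → Fin (m + 1) := fun j =>
      if hj : (j : ℕ) ≤ t then ⟨i + j, by omega⟩
      else ⟨d ⟨j - t - 1, by omega⟩ + 1, by have := hd ⟨j - t - 1, by omega⟩; omega⟩
    have hf1 : ∀ j : Fin (s + t + 1), (j : ℕ) ≤ t → (f j : ℕ) = i + j := fun j hj => by
      simp [f, hj]
    have hf2 : ∀ (j : Fin (s + t + 1)) (hj : ¬ (j : ℕ) ≤ t),
        (f j : ℕ) = d ⟨j - t - 1, by omega⟩ + 1 := fun j hj => by
      simp [f, hj]
    have hlast : ∀ (a b : Fin (s + t + 1)) (hb : ¬ (b : ℕ) ≤ t), a < b →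
        (f a : ℕ) ≤ d ⟨b - t - 1, by omega⟩ := by
      intro a b hb hab
      rw [Fin.lt_def] at hab
      by_cases ha : (a : ℕ) ≤ t
      · have := hd ⟨b - t - 1, by omega⟩
        rw [hf1 a ha]
        omega
      · rw [hf2 a ha]
        exact d.strictMono (Fin.mk_lt_mk.2 (by omega))
    have hf : StrictMono f := by
      intro a b hab
      rw [Fin.lt_def]
      by_cases hb : (b : ℕ) ≤ t
      · rw [Fin.lt_def] at hab
        rw [hf1 a (by omega), hf1 b hb]
        omega
      · rw [hf2 b hb]
        exact Nat.lt_succ_of_le (hlast a b hb hab)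
    have key : ∀ a b, a < b → (π (f a) < π (f b) ↔ α a < α b) := by
      intro a b hab
      rw [h _ _ (hf hab), Fin.lt_def, hα, hα]
      by_cases hb : (b : ℕ) ≤ t
      · have ha : (a : ℕ) ≤ t := by omega
        rw [if_pos ha, if_pos hb, hf1 a ha, hf1 b hb]
        exact iff_of_true (fun k h1 h2 => hrun k (by omega) (by omega)) (by omega)
      · refine iff_of_false (fun hall => ?_) (by split_ifs <;> omega)
        exact (hd _).2 (hall _ (hlast a b hb hab) (by rw [hf2 b hb]; omega))
    refine ⟨f, hf, fun a b => ?_⟩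
    rcases lt_trichotomy a b with hab | rfl | hab
    · exact key a b hab
    · simp
    · have e := key b a hab
      have := π.injective.ne (hf hab).ne
      have := α.injective.ne hab.ne
      grind

theorem ascentSet_eq {m : ℕ} {π : Equiv.Perm (Fin (m + 1))} {A : Finset ℕ}
    (h : IsLayeredBy π A) (hA : A ⊆ Finset.range m) : ascentSet π = A := by
  have key : ∀ k < m, (k ∈ ascentSet π ↔ k ∈ A) := by
    intro k hk
    rw [mem_ascentSet_iff (a := ⟨k, by omega⟩) (b := ⟨k + 1, by omega⟩) rfl,
      h _ _ (Fin.mk_lt_mk.2 (by omega))]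
    refine ⟨fun h => h k le_rfl (Nat.lt_succ_self k), fun h j h1 h2 => ?_⟩
    simp only at h1 h2
    rwa [show j = k by omega]
  ext k
  by_cases hk : k < m
  · exact key k hk
  · exact iff_of_false (fun h => hk (by simp [ascentSet] at h; exact h.1))
      (fun h => hk (by simpa using hA h))

end IsLayeredBy

open Finset in
theorem exists_isLayeredBy (n : ℕ) (A : Finset ℕ) :
    ∃ π : Equiv.Perm (Fin n), IsLayeredBy π A := by
  let c : ℕ → ℤ := fun p => (#(range p \ A) : ℤ)
  have hc : ∀ p q, p ≤ q → c q = c p + #(Ico p q \ A) := by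
    intro p q hpq
    simp only [c]
    rw [← Nat.cast_add, ← card_union_of_disjoint, ← union_sdiff_distrib, range_eq_Ico,
      range_eq_Ico, Ico_union_Ico_eq_Ico (Nat.zero_le _) hpq]
    refine disjoint_left.2 fun x hx hx' => ?_
    simp only [mem_sdiff, mem_range, mem_Ico] at hx hx'
    omega
  let key : Fin n → ℤ := fun p => (p : ℤ) - n * c p
  have hkey : ∀ p q : Fin n, p < q → (key p ≤ key q ↔ ∀ k, (p : ℕ) ≤ k → k < q → k ∈ A) ∧
      key p ≠ key q := by
    intro p q hpq
    have hcq := hc p q hpq.le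
    rw [Fin.lt_def] at hpq
    by_cases hA : ∀ k, (p : ℕ) ≤ k → k < q → k ∈ A
    · have : Ico (p : ℕ) q \ A = ∅ := by
        ext k
        simp only [mem_sdiff, mem_Ico, notMem_empty, iff_false]
        exact fun h => h.2 (hA k h.1.1 h.1.2)
      rw [this, card_empty, Nat.cast_zero, add_zero] at hcq
      simp only [key, hcq]
      exact ⟨iff_of_true (by omega) hA, by omega⟩
    · have hpos : 0 < #(Ico (p : ℕ) q \ A) := by
        push Not at hA
        obtain ⟨k, h1, h2, h3⟩ := hA
        exact card_pos.2 ⟨k, by simp [h1, h2, h3]⟩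
      have : key q < key p := by
        simp only [key, hcq]
        have hq := q.isLt
        have : (1 : ℤ) ≤ #(Ico (p : ℕ) q \ A) := by exact_mod_cast hpos
        nlinarith
      exact ⟨iff_of_false (not_le.2 this) hA, this.ne'⟩
  have hinj : Function.Injective key := by
    intro p q hpq
    by_contra hne
    rcases lt_or_gt_of_ne hne with h | h
    · exact (hkey p q h).2 hpq
    · exact (hkey q p h).2 hpq.symm
  have hmono : StrictMono (key ∘ Tuple.sort key) :=
    (Tuple.monotone_sort key).strictMono_of_injective (hinj.comp (Equiv.injective _))
  refine ⟨(Tuple.sort key).symm, fun p q hpq => ?_⟩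
  rw [← (hkey p q hpq).1, ← hmono.lt_iff_lt, (hkey p q hpq).2.le_iff_lt]
  simp

/-- Let `α = α_{s,t}` be the permutation of `{1,…,s+t+1}` with one-line notation
`s+1, s+2, …, s+t+1, s, s-1, …, 2, 1` (zero-indexed: `α i = s + i` for `i ≤ t` and
`α i = s + t - i` for `i > t`).  Then for `n ≥ 1`,
`|S_n(132, 213, α_{s,t})| = ∑_{k=1}^{s-1} C(n-1,k-1) + ∑_{k=s}^{n} C(k-1,s-1) F_{t,n-k+1}`. -/
theorem statement3 (s t n : ℕ) (hs : 1 ≤ s) (ht : 1 ≤ t) (hn : 1 ≤ n)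
    (α : Equiv.Perm (Fin (s + t + 1)))
    (hα : ∀ i : Fin (s + t + 1),
      (α i : ℕ) = if (i : ℕ) ≤ t then s + (i : ℕ) else s + t - (i : ℕ)) :
    Nat.card {π : Equiv.Perm (Fin n) //
        PAvoids π p132 ∧ PAvoids π p213 ∧ PAvoids π α} =
      (∑ k ∈ Finset.Icc 1 (s - 1), Nat.choose (n - 1) (k - 1)) +
        ∑ k ∈ Finset.Icc s n, Nat.choose (k - 1) (s - 1) * genFib t (n - k + 1) := by
  obtain ⟨m, rfl⟩ : ∃ m, n = m + 1 := ⟨n - 1, by omega⟩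
  obtain ⟨s, rfl⟩ : ∃ s', s = s' + 1 := ⟨s - 1, by omega⟩
  classical
  have hsum : ∑ k ∈ Finset.Icc 1 (s + 1 - 1), Nat.choose (m + 1 - 1) (k - 1) +
      ∑ k ∈ Finset.Icc (s + 1) (m + 1),
        Nat.choose (k - 1) (s + 1 - 1) * genFib t (m + 1 - k + 1) =
      ∑ i ∈ Finset.range s, m.choose i +
        ∑ j ∈ Finset.range (m + 1), j.choose s * genFib t (m + 1 - j) := by
    simp only [Nat.add_sub_cancel]
    congr 1
    · rw [Finset.range_eq_Ico, ← Finset.Ico_add_one_right_eq_Icc]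
      exact (Finset.sum_Ico_add' (fun k => m.choose (k - 1)) 0 s 1).symm
    · have hsub : Finset.Icc (s + 1) (m + 1) ⊆ Finset.Ico (0 + 1) (m + 1 + 1) := fun k hk => by
        simp only [Finset.mem_Icc, Finset.mem_Ico] at hk ⊢
        omega
      rw [Finset.sum_subset hsub, Finset.range_eq_Ico, ← Finset.sum_Ico_add']
      · refine Finset.sum_congr rfl fun j hj => ?_
        rw [Finset.mem_Ico] at hj
        rw [Nat.add_sub_cancel, show m + 1 - (j + 1) + 1 = m + 1 - j by omega]
      · intro k hk hk'
        simp only [Finset.mem_Icc, Finset.mem_Ico] at hk hk'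
        rw [Nat.choose_eq_zero_of_lt (by omega), zero_mul]
  rw [hsum, ← card_not_hasRunBefore t s m ht, ← Nat.card_eq_finsetCard]
  have hlay := fun π : {π : Equiv.Perm (Fin (m + 1)) //
      PAvoids π p132 ∧ PAvoids π p213 ∧ PAvoids π α} => isLayeredBy_ascentSet π.2.1 π.2.2.1
  refine Nat.card_eq_of_bijective (fun π => ⟨ascentSet π.1, Finset.mem_filter.2
    ⟨Finset.mem_powerset.2 (Finset.filter_subset _ _),
      fun h => π.2.2.2 (((hlay π).pContains_iff hs ht hα).2 h)⟩⟩) ⟨fun π π' h => ?_, ?_⟩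
  · have h : ascentSet π.1 = ascentSet π'.1 := congrArg Subtype.val h
    exact Subtype.ext ((hlay π).eq_of_isLayeredBy (h ▸ hlay π'))
  · rintro ⟨A, hA⟩
    rw [Finset.mem_filter, Finset.mem_powerset] at hA
    obtain ⟨π, hπ⟩ := exists_isLayeredBy (m + 1) A
    exact ⟨⟨π, hπ.pAvoids_p132, hπ.pAvoids_p213,
      fun h => hA.2 ((hπ.pContains_iff hs ht hα).1 h)⟩, Subtype.ext (hπ.ascentSet_eq hA.1)⟩
end

section
/- Let a and c be nonnegative integers with a + c ≥ 1 and let b ≥ 2 be an integer. Let β_{a,b,c} be the permutation of {1,…,a+b+c} whose one-line notation is a+b+c, a+b+c−1, …, b+c+1, c+1, c+2, …, b+c, c, c−1, …, 2, 1 (a decreasing block of the a largest values, then an increasing block of b values, then the c smallest values in decreasing order). Then for all n ≥ 1, |S_n(132, 213, β_{a,b,c})| = Σ_{k=1}^{a+c−1} C(n−1, k−1) + Σ_{k=a+c}^{n} C(k−1, a+c−1)·F_{b−1, n−k+1}, where C(x,y) denotes the binomial coefficient. -/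
/-- All parts of `l` except possibly the first `a` and the last `c` are smaller than `b`. -/
def InteriorPartsLT (a b c : ℕ) (l : List ℕ) : Prop :=
  ∀ l₁ x l₂, l = l₁ ++ x :: l₂ → a ≤ l₁.length → c ≤ l₂.length → x < b

theorem InteriorPartsLT.reverse {a b c : ℕ} {l : List ℕ} (h : InteriorPartsLT a b c l) :
    InteriorPartsLT c b a l.reverse := by
  intro l₁ x l₂ hl h₁ h₂
  refine h l₂.reverse x l₁.reverse ?_ (by simpa using h₂) (by simpa using h₁)
  rw [← l.reverse_reverse, hl]
  simp

theorem interiorPartsLT_nil (a b c : ℕ) : InteriorPartsLT a b c [] := by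
  intro l₁ x l₂ hl
  simp at hl

theorem interiorPartsLT_succ_cons {a b c y : ℕ} {l : List ℕ} :
    InteriorPartsLT (a + 1) b c (y :: l) ↔ InteriorPartsLT a b c l := by
  constructor
  · intro h l₁ x l₂ hl h₁ h₂
    exact h (y :: l₁) x l₂ (by simp [hl]) (by simpa using h₁) h₂
  · intro h l₁ x l₂ hl h₁ h₂
    cases l₁ with
    | nil => simp at h₁
    | cons z l₁ =>
      simp only [List.cons_append, List.cons.injEq] at hl
      exact h l₁ x l₂ hl.2 (by simpa using h₁) h₂

theorem interiorPartsLT_zero_zero_cons {b y : ℕ} {l : List ℕ} :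
    InteriorPartsLT 0 b 0 (y :: l) ↔ y < b ∧ InteriorPartsLT 0 b 0 l := by
  constructor
  · intro h
    refine ⟨h [] y l rfl (by simp) (by simp), fun l₁ x l₂ hl _ _ => ?_⟩
    exact h (y :: l₁) x l₂ (by simp [hl]) (by simp) (by simp)
  · rintro ⟨hy, h⟩ l₁ x l₂ hl - -
    cases l₁ with
    | nil =>
      simp only [List.nil_append, List.cons.injEq] at hl
      exact hl.1 ▸ hy
    | cons z l₁ =>
      simp only [List.cons_append, List.cons.injEq] at hl
      exact h l₁ x l₂ hl.2 (by simp) (by simp)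

theorem interiorPartsLT_iff_getElem {a b c : ℕ} {l : List ℕ} :
    InteriorPartsLT a b c l ↔
      ∀ (k : ℕ) (hk : k < l.length), a ≤ k → k + c < l.length → l[k] < b := by
  constructor
  · intro h k hk ha hc
    refine h (l.take k) l[k] (l.drop (k + 1)) (by simp) ?_ ?_
    · simp; omega
    · simp; omega
  · rintro h l₁ x l₂ rfl h₁ h₂
    simpa using h l₁.length (by simp) h₁ (by simp; omega)

/-- The number of compositions of `n` whose list of parts satisfies `P`. -/
noncomputable def compositionCount (P : List ℕ → Prop) (n : ℕ) : ℕ :=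
  Nat.card {c : Composition n // P c.blocks}

theorem compositionCount_zero {P : List ℕ → Prop} (h : P []) : compositionCount P 0 = 1 := by
  have hb (c : Composition 0) : c.blocks = [] := c.blocks_eq_nil.2 rfl
  rw [compositionCount, Nat.card_eq_one_iff_unique]
  refine ⟨⟨fun c d => Subtype.ext (Composition.ext ?_)⟩, ⟨⟨default, ?_⟩⟩⟩
  · rw [hb, hb]
  · rwa [hb]

theorem compositionCount_succ {P Q : List ℕ → Prop} {R : ℕ → Prop} [DecidablePred R]
    (h : ∀ y l, P (y :: l) ↔ R y ∧ Q l) (n : ℕ) :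
    compositionCount P (n + 1) =
      ∑ i ∈ Finset.range (n + 1), if R (i + 1) then compositionCount Q (n - i) else 0 := by
  let f : (Σ i : Fin (n + 1), {c : Composition (n - i) // R (i + 1) ∧ Q c.blocks}) →
      {c : Composition (n + 1) // P c.blocks} := fun x =>
    ⟨⟨((x.1 : ℕ) + 1) :: x.2.1.blocks,
      by
        intro i hi
        rcases List.mem_cons.1 hi with rfl | hi
        · omega
        · exact x.2.1.blocks_pos hi,
      by
        have := x.1.2
        rw [List.sum_cons, x.2.1.blocks_sum]
        omega⟩,
      (h _ _).2 x.2.2⟩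
  have hf : Function.Bijective f := by
    constructor
    · rintro ⟨i, c, hc⟩ ⟨j, d, hd⟩ hij
      have hij := congrArg (fun x => x.1.blocks) hij
      simp only [f, List.cons.injEq, Nat.add_right_cancel_iff] at hij
      obtain rfl : i = j := Fin.ext hij.1
      obtain rfl : c = d := Composition.ext hij.2
      rfl
    · rintro ⟨⟨l, hpos, hsum⟩, hP⟩
      cases l with
      | nil => simp at hsum
      | cons y l =>
        have hy : 0 < y := hpos (by simp)
        rw [List.sum_cons] at hsum
        have hy' : y - 1 + 1 = y := by omega
        refine ⟨⟨⟨y - 1, by omega⟩, ⟨l, fun hi => hpos (by simp [hi]), ?_⟩, ?_⟩, ?_⟩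
        · change l.sum = n - (y - 1)
          omega
        · change R (y - 1 + 1) ∧ Q l
          rw [hy']
          exact (h _ _).1 hP
        · apply Subtype.ext
          apply Composition.ext
          simp [f, hy']
  rw [compositionCount, ← Nat.card_congr (Equiv.ofBijective f hf), Nat.card_sigma,
    ← Fin.sum_univ_eq_sum_range
      (fun i => if R (i + 1) then compositionCount Q (n - i) else 0)]
  refine Finset.sum_congr rfl fun i _ => ?_
  split_ifs with hR
  · simp only [hR, true_and, compositionCount]
  · simp [hR]

theorem compositionCount_interiorPartsLT_comm (a b c n : ℕ) :
    compositionCount (InteriorPartsLT a b c) n = compositionCount (InteriorPartsLT c b a) n := by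
  have hrev {a c : ℕ} (x : Composition n) (hx : InteriorPartsLT a b c x.blocks) :
      InteriorPartsLT c b a x.reverse.blocks := by
    simpa [Composition.reverse] using hx.reverse
  exact Nat.card_congr
    { toFun := fun x => ⟨x.1.reverse, hrev x.1 x.2⟩
      invFun := fun x => ⟨x.1.reverse, hrev x.1 x.2⟩
      left_inv := fun x => by simp
      right_inv := fun x => by simp }

theorem compositionCount_interiorPartsLT_succ (a b c n : ℕ) :
    compositionCount (InteriorPartsLT (a + 1) b c) (n + 1) =
      ∑ j ∈ Finset.range (n + 1), compositionCount (InteriorPartsLT a b c) j := by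
  rw [compositionCount_succ (R := fun _ => True) (Q := InteriorPartsLT a b c)
    (fun y l => by rw [interiorPartsLT_succ_cons, true_and])]
  simp only [if_true]
  exact Finset.sum_range_reflect (fun j => compositionCount (InteriorPartsLT a b c) j) (n + 1)

theorem compositionCount_parts_lt {b : ℕ} (hb : 1 ≤ b) (n : ℕ) :
    compositionCount (InteriorPartsLT 0 b 0) n = genFib (b - 1) (n + 1) := by
  induction n using Nat.strong_induction_on with
  | _ n ih =>
    cases n with
    | zero => rw [compositionCount_zero (interiorPartsLT_nil _ _ _), genFib]
    | succ n =>
      rw [compositionCount_succ (R := fun y => y < b) (Q := InteriorPartsLT 0 b 0)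
        (fun y l => interiorPartsLT_zero_zero_cons), genFib, ← Finset.sum_filter]
      have hsub : (Finset.range (n + 1)).filter (fun i => i + 1 < b) ⊆ Finset.range (b - 1) := by
        intro i
        simp only [Finset.mem_filter, Finset.mem_range]
        omega
      rw [← Finset.sum_subset hsub]
      · refine Finset.sum_congr rfl fun i hi => ?_
        simp only [Finset.mem_filter, Finset.mem_range] at hi
        rw [ih _ (by omega)]
        congr 1
        omega
      · intro i hi hi'
        simp only [Finset.mem_filter, Finset.mem_range] at hi hi'
        rw [show n + 1 - i = 0 by omega, genFib]

theorem compositionCount_interiorPartsLT_add (a b c n : ℕ) :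
    compositionCount (InteriorPartsLT a b c) n =
      compositionCount (InteriorPartsLT (a + c) b 0) n := by
  induction a generalizing n with
  | zero => rw [compositionCount_interiorPartsLT_comm, zero_add]
  | succ a ih =>
    cases n with
    | zero => simp only [compositionCount_zero (interiorPartsLT_nil _ _ _)]
    | succ n =>
      rw [Nat.add_right_comm, compositionCount_interiorPartsLT_succ,
        compositionCount_interiorPartsLT_succ]
      exact Finset.sum_congr rfl fun j _ => ih j

theorem compositionCount_interiorPartsLT_eq_sum {b : ℕ} (hb : 1 ≤ b) (s n : ℕ) :
    compositionCount (InteriorPartsLT (s + 1) b 0) (n + 1) =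
      ∑ k ∈ Finset.range s, n.choose k +
        ∑ k ∈ Finset.range (n + 1), k.choose s * genFib (b - 1) (n - k + 1) := by
  induction s generalizing n with
  | zero =>
    rw [compositionCount_interiorPartsLT_succ, ← Finset.sum_range_reflect]
    simp [compositionCount_parts_lt hb]
  | succ s ihs =>
    induction n with
    | zero =>
      rw [compositionCount_interiorPartsLT_succ, Finset.sum_range_succ']
      simp [compositionCount_zero (interiorPartsLT_nil _ _ _), Finset.sum_range_succ']
    | succ n ihn =>
      rw [compositionCount_interiorPartsLT_succ, Finset.sum_range_succ,
        ← compositionCount_interiorPartsLT_succ, ihn, ihs, Finset.sum_range_succ' _ (n + 1),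
        Finset.sum_range_succ' (fun k => (n + 1).choose k)]
      simp only [Nat.choose_succ_succ, Nat.add_sub_add_right, add_mul, Finset.sum_add_distrib,
        Finset.sum_range_succ' (fun k => n.choose k)]
      simp
      ring

theorem sum_choose_add_sum_choose_mul_genFib (k s n : ℕ) :
    (∑ i ∈ Finset.Icc 1 s, n.choose (i - 1)) +
        ∑ i ∈ Finset.Icc (s + 1) (n + 1), (i - 1).choose s * genFib k (n + 1 - i + 1) =
      ∑ i ∈ Finset.range s, n.choose i +
        ∑ i ∈ Finset.range (n + 1), i.choose s * genFib k (n - i + 1) := by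
  have hIcc (m : ℕ) : Finset.Icc 1 m = Finset.Ico 1 (m + 1) := by ext; simp
  have hsub : Finset.Icc (s + 1) (n + 1) ⊆ Finset.Icc 1 (n + 1) :=
    Finset.Icc_subset_Icc (by omega) le_rfl
  rw [Finset.sum_subset hsub, hIcc, hIcc, Finset.sum_Ico_eq_sum_range,
    Finset.sum_Ico_eq_sum_range]
  · simp [Nat.add_comm 1]
  · intro i hi hi'
    simp only [Finset.mem_Icc] at hi hi'
    rw [Nat.choose_eq_zero_of_lt (by omega), zero_mul]

namespace Composition

variable {n : ℕ}

theorem mem_boundaries_iff (C : Composition n) {p : Fin (n + 1)} :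
    p ∈ C.boundaries ↔ ∃ k, C.sizeUpTo k = p := by
  constructor
  · intro h
    obtain ⟨k, -, rfl⟩ := Finset.mem_map.1 h
    exact ⟨k, rfl⟩
  · rintro ⟨k, hk⟩
    refine Finset.mem_map.2 ⟨⟨min k C.length, by omega⟩, Finset.mem_univ _, Fin.ext ?_⟩
    change C.sizeUpTo (min k C.length) = p
    rcases le_total k C.length with h | h
    · rwa [min_eq_left h]
    · rw [min_eq_right h, C.sizeUpTo_length, ← hk, C.sizeUpTo_ofLength_le k h]

theorem monotone_index (C : Composition n) : Monotone C.index := by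
  intro i j hij
  by_contra! h
  have h₁ := C.sizeUpTo_index_le i
  have h₂ := C.lt_sizeUpTo_index_succ j
  have h₃ := C.monotone_sizeUpTo (show (C.index j).succ.val ≤ (C.index i).val from h)
  have : (i : ℕ) ≤ j := hij
  omega

theorem index_eq_index_iff (C : Composition n) {i j : Fin n} (hij : i < j) :
    C.index i = C.index j ↔
      ∀ p ∈ C.boundaries, ¬ ((i : ℕ) < (p : ℕ) ∧ (p : ℕ) ≤ (j : ℕ)) := by
  constructor
  · rintro h p hp ⟨hip, hpj⟩
    obtain ⟨k, hk⟩ := C.mem_boundaries_iff.1 hp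
    have h₁ := C.sizeUpTo_index_le i
    have h₂ := C.lt_sizeUpTo_index_succ j
    rw [← h] at h₂
    rcases Nat.lt_or_ge (C.index i) k with hlt | hge
    · have h₃ := C.monotone_sizeUpTo (show (C.index i).succ.val ≤ k from hlt)
      omega
    · have h₃ := C.monotone_sizeUpTo hge
      omega
  · intro h
    by_contra hne
    have hlt : C.index i < C.index j := lt_of_le_of_ne (C.monotone_index hij.le) hne
    have h₁ := C.lt_sizeUpTo_index_succ i
    have h₂ := C.sizeUpTo_index_le j
    have h₃ := C.monotone_sizeUpTo (show (C.index i).succ.val ≤ (C.index j).val from hlt)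
    exact h ⟨C.sizeUpTo (C.index j), by have := C.sizeUpTo_le (C.index j); omega⟩
      (C.mem_boundaries_iff.2 ⟨_, rfl⟩) ⟨by simp only; omega, h₂⟩

theorem zero_mem_boundaries (C : Composition n) : 0 ∈ C.boundaries := C.toCompositionAsSet.zero_mem

theorem last_mem_boundaries (C : Composition n) : Fin.last n ∈ C.boundaries :=
  C.toCompositionAsSet.getLast_mem

theorem eq_of_boundaries_eq {C D : Composition n} (h : C.boundaries = D.boundaries) : C = D :=
  (compositionEquiv n).injective (CompositionAsSet.ext h)

/-- A composition is determined by which positions lie in a common block. -/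
theorem eq_of_index_eq_iff {C D : Composition n}
    (h : ∀ i j, i < j → (C.index i = C.index j ↔ D.index i = D.index j)) : C = D := by
  have key {C D : Composition n}
      (h : ∀ i j, i < j → (C.index i = C.index j ↔ D.index i = D.index j))
      {p : Fin (n + 1)} (hp : p ∈ C.boundaries) : p ∈ D.boundaries := by
    by_cases h0 : (p : ℕ) = 0
    · rw [show p = 0 from Fin.ext h0]
      exact D.zero_mem_boundaries
    by_cases hn : (p : ℕ) = n
    · rw [show p = Fin.last n from Fin.ext hn]
      exact D.last_mem_boundaries
    have hlt : (⟨p - 1, by omega⟩ : Fin n) < ⟨p, by omega⟩ := Fin.mk_lt_mk.2 (by omega)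
    by_contra hpD
    refine (C.index_eq_index_iff hlt).1 ((h _ _ hlt).2 ?_) p hp ⟨by simp only; omega, le_rfl⟩
    refine (D.index_eq_index_iff hlt).2 fun q hq hpq => hpD ?_
    rwa [show p = q from Fin.ext (by simp only at hpq; omega)]
  exact eq_of_boundaries_eq (Finset.ext fun p =>
    ⟨key h, key fun i j hij => (h i j hij).symm⟩)

end Composition

/-- `π` is the permutation whose one-line notation splits into the blocks of `C`, each block
increasing and lying entirely above all later blocks. -/
def IsBlockPerm {n : ℕ} (C : Composition n) (π : Equiv.Perm (Fin n)) : Prop :=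
  ∀ i j, i < j → (π i < π j ↔ C.index i = C.index j)

theorem exists_isBlockPerm {n : ℕ} (C : Composition n) : ∃ π, IsBlockPerm C π := by
  let f : Fin n → (Fin C.length)ᵒᵈ ×ₗ Fin n := fun i => toLex (OrderDual.toDual (C.index i), i)
  have hf : Function.Injective f := fun i j h => (Prod.ext_iff.1 (toLex.injective h)).2
  have hmono : StrictMono (f ∘ Tuple.sort f) :=
    (Tuple.monotone_sort f).strictMono_of_injective (hf.comp (Tuple.sort f).injective)
  refine ⟨(Tuple.sort f).symm, fun i j hij => ?_⟩
  rw [← hmono.lt_iff_lt]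
  simp only [Function.comp_apply, Equiv.apply_symm_apply, f, Prod.Lex.toLex_lt_toLex,
    OrderDual.toDual_lt_toDual, OrderDual.toDual_inj]
  simp [hij, (C.monotone_index hij.le).not_gt]

namespace IsBlockPerm

variable {n : ℕ} {C D : Composition n} {π ρ : Equiv.Perm (Fin n)}

theorem composition_unique (hC : IsBlockPerm C π) (hD : IsBlockPerm D π) : C = D :=
  Composition.eq_of_index_eq_iff fun i j hij => (hC i j hij).symm.trans (hD i j hij)

theorem perm_unique (hπ : IsBlockPerm C π) (hρ : IsBlockPerm C ρ) : π = ρ := by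
  have hlt (i j : Fin n) : π i < π j → ρ i < ρ j := by
    intro h
    rcases lt_trichotomy i j with hij | rfl | hij
    · exact (hρ i j hij).2 ((hπ i j hij).1 h)
    · exact absurd h (lt_irrefl _)
    · refine lt_of_le_of_ne (not_lt.1 fun h' => ?_) fun h' => hij.ne' (ρ.injective h')
      exact h.not_gt ((hπ j i hij).2 ((hρ j i hij).1 h'))
  have hmono : StrictMono (ρ * π⁻¹) := fun x y hxy => by
    simpa using hlt (π⁻¹ x) (π⁻¹ y) (by simpa using hxy)
  have := (Equiv.Perm.monotone_iff _).1 hmono.monotone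
  exact (mul_inv_eq_one.1 this).symm

theorem pAvoids_p132 (h : IsBlockPerm C π) : PAvoids π p132 := by
  rintro ⟨f, hf, hp⟩
  have h01 := (h _ _ (hf (show (0 : Fin 3) < 1 by decide))).1
    ((hp 0 1).2 (show (0 : Fin 3) < 2 by decide))
  have h02 := (h _ _ (hf (show (0 : Fin 3) < 2 by decide))).1
    ((hp 0 2).2 (show (0 : Fin 3) < 1 by decide))
  have h12 := (h _ _ (hf (show (1 : Fin 3) < 2 by decide))).2 (h01.symm.trans h02)
  exact absurd ((hp 1 2).1 h12) (show ¬ (2 : Fin 3) < 1 by decide)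

theorem pAvoids_p213 (h : IsBlockPerm C π) : PAvoids π p213 := by
  rintro ⟨f, hf, hp⟩
  have h02 := (h _ _ (hf (show (0 : Fin 3) < 2 by decide))).1
    ((hp 0 2).2 (show (1 : Fin 3) < 2 by decide))
  have h12 := (h _ _ (hf (show (1 : Fin 3) < 2 by decide))).1
    ((hp 1 2).2 (show (0 : Fin 3) < 2 by decide))
  have h01 := (h _ _ (hf (show (0 : Fin 3) < 1 by decide))).2 (h02.trans h12.symm)
  exact absurd ((hp 0 1).1 h01) (show ¬ (1 : Fin 3) < 0 by decide)

end IsBlockPerm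

theorem pContains_p132 {n : ℕ} {π : Equiv.Perm (Fin n)} {i j k : Fin n} (hij : i < j)
    (hjk : j < k) (h₁ : π i < π k) (h₂ : π k < π j) : PContains π p132 := by
  refine ⟨![i, j, k], by simp [Fin.strictMono_iff_lt_succ, Fin.forall_fin_two, hij, hjk], ?_⟩
  intro s t
  fin_cases s <;> fin_cases t <;>
    simp [p132, h₁, h₂, h₁.trans h₂, h₁.le, h₂.le, (h₁.trans h₂).le]

theorem pContains_p213 {n : ℕ} {π : Equiv.Perm (Fin n)} {i j k : Fin n} (hij : i < j)
    (hjk : j < k) (h₁ : π j < π i) (h₂ : π i < π k) : PContains π p213 := by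
  refine ⟨![i, j, k], by simp [Fin.strictMono_iff_lt_succ, Fin.forall_fin_two, hij, hjk], ?_⟩
  intro s t
  fin_cases s <;> fin_cases t <;>
    simp [p213, h₁, h₂, h₁.trans h₂, h₁.le, h₂.le, (h₁.trans h₂).le]

/-- In a permutation avoiding `132` and `213`, the entries at `i < j` are increasing exactly when
there is no descent between the positions `i` and `j`. -/
theorem lt_iff_forall_not_descent {n : ℕ} {π : Equiv.Perm (Fin n)} (h132 : PAvoids π p132)
    (h213 : PAvoids π p213) {i j : Fin n} (hij : i < j) :
    π i < π j ↔ ∀ k l : Fin n, i ≤ k → (k : ℕ) + 1 = l → l ≤ j → π k < π l := by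
  constructor
  · intro h k l hik hkl hlj
    have hkl' : k < l := Fin.lt_def.2 (by omega)
    by_contra hlt
    have hlk : π l < π k := lt_of_le_of_ne (not_lt.1 hlt) fun he => hkl'.ne' (π.injective he)
    have hjk : π j < π k := by
      rcases hlj.eq_or_lt with rfl | hlj
      · exact hlk
      · refine lt_of_le_of_ne (not_lt.1 fun hkj => ?_) fun he =>
          (hkl'.trans hlj).ne' (π.injective he)
        exact h213 (pContains_p213 hkl' hlj hlk hkj)
    rcases hik.eq_or_lt with rfl | hik
    · exact h.not_gt hjk
    · exact h132 (pContains_p132 hik (hkl'.trans_le hlj) h hjk)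
  · intro h
    obtain ⟨j, hj⟩ := j
    induction j with
    | zero => exact absurd hij (Nat.not_lt_zero _)
    | succ j ih =>
      have hstep : π ⟨j, by omega⟩ < π ⟨j + 1, hj⟩ :=
        h ⟨j, by omega⟩ _ (Fin.le_def.2 (Nat.lt_succ_iff.1 hij)) rfl le_rfl
      rcases (Nat.lt_succ_iff.1 hij).eq_or_lt with he | hlt
      · rwa [show i = ⟨j, by omega⟩ from Fin.ext he]
      · exact (ih (by omega) hlt fun k l hik hkl hlj =>
          h k l hik hkl (hlj.trans (Fin.mk_le_mk.2 j.le_succ))).trans hstep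

theorem exists_composition_isBlockPerm {n : ℕ} {π : Equiv.Perm (Fin n)} (h132 : PAvoids π p132)
    (h213 : PAvoids π p213) : ∃ C, IsBlockPerm C π := by
  classical
  let S : CompositionAsSet n :=
    { boundaries := {p | (p : ℕ) = 0 ∨ (p : ℕ) = n ∨
        ∃ k l : Fin n, (k : ℕ) + 1 = l ∧ (l : ℕ) = p ∧ π l < π k}
      zero_mem := by simp
      getLast_mem := by simp }
  refine ⟨S.toComposition, fun i j hij => ?_⟩
  rw [lt_iff_forall_not_descent h132 h213 hij, Composition.index_eq_index_iff _ hij,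
    S.toComposition_boundaries]
  simp only [S, Finset.mem_filter, Finset.mem_univ, true_and]
  constructor
  · rintro h p (hp | hp | ⟨k, l, hkl, hlp, hlt⟩) ⟨hip, hpj⟩
    · omega
    · omega
    · exact (h k l (Fin.le_def.2 (by omega)) hkl (Fin.le_def.2 (by omega))).not_gt hlt
  · intro h k l hik hkl hlj
    by_contra hlt
    have hne : π l ≠ π k := fun he => by
      rw [π.injective he] at hkl
      omega
    exact h l.castSucc (Or.inr (Or.inr ⟨k, l, hkl, rfl, lt_of_le_of_ne (not_lt.1 hlt) hne⟩))
      ⟨by have := Fin.le_def.1 hik; simp only [Fin.val_castSucc]; omega, hlj⟩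

theorem add_val_le_of_strictMonoOn {f : ℕ → ℕ} {m p : ℕ}
    (h : ∀ s t, m ≤ s → s < t → t ≤ p → f s < f t) {s : ℕ} (hms : m ≤ s) (hsp : s ≤ p) :
    f m + (s - m) ≤ f s := by
  induction s, hms using Nat.le_induction with
  | base => simp
  | succ s hms ih =>
    have := ih (by omega)
    have := h s (s + 1) hms (by omega) hsp
    omega

/-- Entries of `β` at positions `s < t` are increasing exactly when both lie in its middle block. -/
theorem layered_lt_iff {a b c : ℕ} (β : Equiv.Perm (Fin (a + b + c)))
    (hβ : ∀ i : Fin (a + b + c),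
      (β i : ℕ) = if (i : ℕ) < a ∨ a + b ≤ (i : ℕ) then a + b + c - 1 - (i : ℕ)
        else c + ((i : ℕ) - a)) {s t : Fin (a + b + c)} (hst : s < t) :
    β s < β t ↔ a ≤ (s : ℕ) ∧ (t : ℕ) < a + b := by
  have := Fin.lt_def.1 hst
  have := t.isLt
  rw [Fin.lt_def, hβ s, hβ t]
  split_ifs <;> omega

theorem pContains_iff_of_lt_iff {n m : ℕ} {π : Equiv.Perm (Fin n)} {σ : Equiv.Perm (Fin m)} :
    PContains π σ ↔ ∃ f : Fin m → Fin n, StrictMono f ∧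
      ∀ s t, s < t → (π (f s) < π (f t) ↔ σ s < σ t) := by
  refine exists_congr fun f => and_congr_right fun hf => ⟨fun h s t _ => h s t, fun h s t => ?_⟩
  rcases lt_trichotomy s t with hst | rfl | hst
  · exact h s t hst
  · simp
  · have hne : π (f t) ≠ π (f s) := fun he => (hf hst).ne (π.injective he)
    have hne' : σ t ≠ σ s := fun he => hst.ne (σ.injective he)
    rw [← not_iff_not, not_lt, not_lt, hne.le_iff_lt, hne'.le_iff_lt]
    exact h t s hst

theorem IsBlockPerm.pContains_iff {n a b c : ℕ} (hb : 1 ≤ b) {C : Composition n}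
    {π : Equiv.Perm (Fin n)} (h : IsBlockPerm C π) (β : Equiv.Perm (Fin (a + b + c)))
    (hβ : ∀ i : Fin (a + b + c),
      (β i : ℕ) = if (i : ℕ) < a ∨ a + b ≤ (i : ℕ) then a + b + c - 1 - (i : ℕ)
        else c + ((i : ℕ) - a)) :
    PContains π β ↔ ∃ (k : ℕ) (hk : k < C.length), a ≤ k ∧ k + c < C.length ∧ b ≤ C.blocks[k] := by
  rw [pContains_iff_of_lt_iff]
  constructor
  · rintro ⟨f, hf, hord⟩
    have hidx {s t : Fin (a + b + c)} (hst : s < t) :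
        C.index (f s) = C.index (f t) ↔ a ≤ (s : ℕ) ∧ (t : ℕ) < a + b := by
      rw [← h _ _ (hf hst), hord s t hst, layered_lt_iff β hβ hst]
    let pos : ℕ → ℕ := fun s => if hs : s < a + b + c then f ⟨s, hs⟩ else 0
    let blk : ℕ → ℕ := fun s => if hs : s < a + b + c then C.index (f ⟨s, hs⟩) else 0
    have hpos (s t : ℕ) (hst : s < t) (ht : t < a + b + c) : pos s < pos t := by
      simp only [pos, dif_pos ht, dif_pos (hst.trans ht)]
      exact hf (Fin.mk_lt_mk.2 hst)
    have hblk (s t : ℕ) (hst : s < t) (ht : t < a + b + c) (hn : s < a ∨ a + b ≤ t) :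
        blk s < blk t := by
      simp only [blk, dif_pos ht, dif_pos (hst.trans ht)]
      have hlt : (⟨s, hst.trans ht⟩ : Fin (a + b + c)) < ⟨t, ht⟩ := Fin.mk_lt_mk.2 hst
      refine lt_of_le_of_ne (C.monotone_index (hf hlt).le) fun he => ?_
      have := (hidx hlt).1 (Fin.ext he)
      simp only at this
      omega
    have hmid : blk a = blk (a + b - 1) := by
      rcases (show a ≤ a + b - 1 by omega).eq_or_lt with he | hlt
      · rw [← he]
      · simp only [blk, dif_pos (show a < a + b + c by omega),
          dif_pos (show a + b - 1 < a + b + c by omega)]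
        exact congrArg Fin.val ((hidx (Fin.mk_lt_mk.2 hlt)).2 ⟨le_rfl, by simp only; omega⟩)
    have hblk_lt (s : ℕ) (hs : s < a + b + c) : blk s < C.length := by
      simp only [blk, dif_pos hs, Fin.is_lt]
    have hlow (s : ℕ) (hs : s < a + b + c) : C.sizeUpTo (blk s) ≤ pos s := by
      simp only [blk, pos, dif_pos hs, C.sizeUpTo_index_le]
    have hupp (s : ℕ) (hs : s < a + b + c) : pos s < C.sizeUpTo (blk s + 1) := by
      simp only [blk, pos, dif_pos hs]
      exact C.lt_sizeUpTo_index_succ _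
    have hka := hblk_lt a (by omega)
    have h₁ := add_val_le_of_strictMonoOn (f := blk) (m := 0) (p := a)
      (fun s t _ hst ht => hblk s t hst (by omega) (Or.inl (by omega))) (Nat.zero_le a) le_rfl
    have h₂ := add_val_le_of_strictMonoOn (f := blk) (m := a + b - 1) (p := a + b - 1 + c)
      (fun s t hs hst ht => hblk s t hst (by omega) (Or.inr (by omega)))
      (Nat.le_add_right _ c) le_rfl
    have h₃ := add_val_le_of_strictMonoOn (f := pos) (m := a) (p := a + b - 1)
      (fun s t _ hst ht => hpos s t hst (by omega)) (show a ≤ a + b - 1 by omega) le_rfl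
    have h₄ := hblk_lt (a + b - 1 + c) (by omega)
    have h₅ := hlow a (by omega)
    have h₆ := hupp (a + b - 1) (by omega)
    rw [← hmid, C.sizeUpTo_succ hka] at h₆
    exact ⟨blk a, hka, by omega, by omega, by omega⟩
  · rintro ⟨k, hk, hak, hkc, hbk⟩
    -- the block and the offset within that block used for each entry of the pattern
    let blk : Fin (a + b + c) → Fin C.length := fun s =>
      ⟨if (s : ℕ) < a then s else if (s : ℕ) < a + b then k else k + 1 + (s - (a + b)), by
        have := s.isLt
        split_ifs <;> omega⟩
    let off : Fin (a + b + c) → ℕ := fun s =>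
      if (s : ℕ) < a then 0 else if (s : ℕ) < a + b then s - a else 0
    have hoff (s : Fin (a + b + c)) : off s < C.blocksFun (blk s) := by
      have hpos := C.one_le_blocksFun (blk s)
      by_cases h₁ : (s : ℕ) < a
      · simp only [off, if_pos h₁]
        omega
      by_cases h₂ : (s : ℕ) < a + b
      · have hblk : blk s = ⟨k, hk⟩ := Fin.ext (by simp only [blk, if_neg h₁, if_pos h₂])
        have : C.blocksFun ⟨k, hk⟩ = C.blocks[k] := rfl
        simp only [off, if_neg h₁, if_pos h₂, hblk]
        omega
      · simp only [off, if_neg h₁, if_neg h₂]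
        omega
    let f : Fin (a + b + c) → Fin n := fun s => C.embedding (blk s) ⟨off s, hoff s⟩
    have hidx (s : Fin (a + b + c)) : C.index (f s) = blk s := C.index_embedding _ _
    have hblk {s t : Fin (a + b + c)} (hst : s < t) :
        (blk s = blk t ∧ off s < off t ∧ a ≤ (s : ℕ) ∧ (t : ℕ) < a + b) ∨
          (blk s < blk t ∧ ¬ (a ≤ (s : ℕ) ∧ (t : ℕ) < a + b)) := by
      have := Fin.lt_def.1 hst
      simp only [blk, off, Fin.mk.injEq, Fin.mk_lt_mk]
      split_ifs <;> omega
    have hf : StrictMono f := by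
      intro s t hst
      rcases hblk hst with ⟨he, ho, -⟩ | ⟨hlt, -⟩
      · rw [Fin.lt_def]
        simp only [f, Composition.coe_embedding, he]
        omega
      · by_contra hle
        have := C.monotone_index (not_lt.1 hle)
        rw [hidx, hidx] at this
        exact this.not_gt hlt
    refine ⟨f, hf, fun s t hst => ?_⟩
    rw [h _ _ (hf hst), hidx, hidx, layered_lt_iff β hβ hst]
    rcases hblk hst with ⟨he, -, hm⟩ | ⟨hlt, hm⟩
    · exact iff_of_true he hm
    · exact iff_of_false hlt.ne hm

theorem card_avoiding_eq_compositionCount {a b c n : ℕ} (hb : 1 ≤ b)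
    (β : Equiv.Perm (Fin (a + b + c)))
    (hβ : ∀ i : Fin (a + b + c),
      (β i : ℕ) = if (i : ℕ) < a ∨ a + b ≤ (i : ℕ) then a + b + c - 1 - (i : ℕ)
        else c + ((i : ℕ) - a)) :
    Nat.card {π : Equiv.Perm (Fin n) // PAvoids π p132 ∧ PAvoids π p213 ∧ PAvoids π β} =
      compositionCount (InteriorPartsLT a b c) n := by
  have havoid {C : Composition n} {π : Equiv.Perm (Fin n)} (h : IsBlockPerm C π) :
      PAvoids π β ↔ InteriorPartsLT a b c C.blocks := by
    rw [PAvoids, h.pContains_iff hb β hβ, interiorPartsLT_iff_getElem]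
    push Not
    rfl
  choose C hC using fun π : {π : Equiv.Perm (Fin n) //
    PAvoids π p132 ∧ PAvoids π p213 ∧ PAvoids π β} =>
      exists_composition_isBlockPerm π.2.1 π.2.2.1
  refine Nat.card_congr (Equiv.ofBijective
    (fun π => ⟨C π, (havoid (hC π)).1 π.2.2.2⟩) ⟨fun π ρ h => ?_, fun D => ?_⟩)
  · have hCD : C π = C ρ := congrArg Subtype.val h
    exact Subtype.ext ((hC π).perm_unique (hCD ▸ hC ρ))
  · obtain ⟨π, hπ⟩ := exists_isBlockPerm D.1
    exact ⟨⟨π, hπ.pAvoids_p132, hπ.pAvoids_p213, (havoid hπ).2 D.2⟩,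
      Subtype.ext ((hC _).composition_unique hπ)⟩

/-- Let `β = β_{a,b,c}` be the permutation of `{1,…,a+b+c}` with one-line notation
`a+b+c, …, b+c+1, c+1, c+2, …, b+c, c, c-1, …, 1` (zero-indexed: `β i = a+b+c-1-i`
for `i < a` or `i ≥ a+b`, and `β i = c + (i - a)` for `a ≤ i < a+b`).  Then for `n ≥ 1`,
`|S_n(132, 213, β_{a,b,c})| = ∑_{k=1}^{a+c-1} C(n-1,k-1)
  + ∑_{k=a+c}^{n} C(k-1,a+c-1) F_{b-1,n-k+1}`. -/
theorem statement4 (a b c n : ℕ) (hac : 1 ≤ a + c) (hb : 2 ≤ b) (hn : 1 ≤ n)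
    (β : Equiv.Perm (Fin (a + b + c)))
    (hβ : ∀ i : Fin (a + b + c),
      (β i : ℕ) = if (i : ℕ) < a ∨ a + b ≤ (i : ℕ) then a + b + c - 1 - (i : ℕ)
        else c + ((i : ℕ) - a)) :
    Nat.card {π : Equiv.Perm (Fin n) //
        PAvoids π p132 ∧ PAvoids π p213 ∧ PAvoids π β} =
      (∑ k ∈ Finset.Icc 1 (a + c - 1), Nat.choose (n - 1) (k - 1)) +
        ∑ k ∈ Finset.Icc (a + c) n,
          Nat.choose (k - 1) (a + c - 1) * genFib (b - 1) (n - k + 1) := by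
  obtain ⟨s, hs⟩ : ∃ s, a + c = s + 1 := ⟨a + c - 1, by omega⟩
  obtain ⟨m, rfl⟩ : ∃ m, n = m + 1 := ⟨n - 1, by omega⟩
  rw [card_avoiding_eq_compositionCount (by omega) β hβ, compositionCount_interiorPartsLT_add, hs,
    compositionCount_interiorPartsLT_eq_sum (by omega), Nat.add_sub_cancel, Nat.add_sub_cancel,
    sum_choose_add_sum_choose_mul_genFib]
end

section
/- Let b ≥ 3 be an integer and let γ_{0,b,2} be the permutation of {1,…,b+3} whose one-line notation is b+2, b+1, …, 4, 3, b+3, 2, 1. Then for all n ≥ 3, |S_n(132, 123, γ_{0,b,2})| = Σ_{k=1}^{n−1} F_{b,k} + 2·Σ_{k=1}^{n−2} F_{b,k}. -/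
/-- The pattern 123 (the identity permutation of `{1,2,3}`). -/
def p123 : Equiv.Perm (Fin 3) := Equiv.refl (Fin 3)

/-- Every entry of `π` has at most one larger entry to its right. -/
def AtMostOneLarger {n : ℕ} (π : Equiv.Perm (Fin n)) : Prop :=
  ∀ i j l : Fin n, i < j → i < l → π i < π j → π i < π l → j = l

/-- The predicate cut out by the formula for `γ_{0,b,2}`, zero-indexed. -/
def IsGamma (b : ℕ) (γ : Equiv.Perm (Fin (b + 3))) : Prop :=
  ∀ i : Fin (b + 3), (γ i : ℕ) = if (i : ℕ) < b then b + 1 - (i : ℕ)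
    else if (i : ℕ) = b then b + 2 else b + 2 - (i : ℕ)

lemma p132_apply (i : Fin 3) : p132 i = ![0, 2, 1] i := rfl

lemma avoids_p132_p123_iff {n : ℕ} (π : Equiv.Perm (Fin n)) :
    PAvoids π p132 ∧ PAvoids π p123 ↔ AtMostOneLarger π := by
  constructor
  · rintro ⟨h132, h123⟩
    have key : ∀ i j l : Fin n, i < j → j < l → π i < π j → π i < π l → False := by
      intro i j l hij hjl h1 h2
      have hmono : StrictMono ![i, j, l] := by
        rw [Fin.strictMono_iff_lt_succ]
        intro t
        fin_cases t
        · exact hij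
        · exact hjl
      rcases lt_trichotomy (π j) (π l) with h | h | h
      · refine h123 ⟨![i, j, l], hmono, ?_⟩
        intro s t
        fin_cases s <;> fin_cases t <;>
          simp [p123, h, h1, h2, h.le, h1.le, h2.le]
      · exact hjl.ne (π.injective h)
      · refine h132 ⟨![i, j, l], hmono, ?_⟩
        intro s t
        fin_cases s <;> fin_cases t <;>
          simp [p132_apply, h, h1, h2, h.le, h1.le, h2.le]
    intro i j l hij hil h1 h2
    rcases lt_trichotomy j l with h | h | h
    · exact (key i j l hij h h1 h2).elim
    · exact h
    · exact (key i l j hil h h2 h1).elim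
  · intro h
    constructor
    · rintro ⟨f, hf, hfσ⟩
      have := h (f 0) (f 1) (f 2) (hf (by decide)) (hf (by decide))
        ((hfσ 0 1).2 (by simp [p132_apply])) ((hfσ 0 2).2 (by simp [p132_apply]))
      exact absurd (hf.injective this) (by decide)
    · rintro ⟨f, hf, hfσ⟩
      have := h (f 0) (f 1) (f 2) (hf (by decide)) (hf (by decide))
        ((hfσ 0 1).2 (by simp [p123])) ((hfσ 0 2).2 (by simp [p123]))
      exact absurd (hf.injective this) (by decide)

/-- The permutation `n-1, n-2, …, n-k, n` followed by `ρ`, where `n = k + 1 + m`. -/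
noncomputable def glue {k m n : ℕ} (h : k + 1 + m = n) (ρ : Equiv.Perm (Fin m)) :
    Equiv.Perm (Fin n) :=
  Equiv.ofBijective
    (fun i : Fin n =>
      if h₁ : (i : ℕ) < k then (⟨n - 2 - i, by omega⟩ : Fin n)
      else if h₂ : (i : ℕ) = k then ⟨n - 1, by omega⟩
      else ⟨ρ ⟨i - (k + 1), by omega⟩, by omega⟩)
    (Finite.injective_iff_bijective.1 (by
      intro i j hij
      dsimp only at hij
      split_ifs at hij <;> rw [Fin.mk.injEq] at hij
      · ext; omega
      · omega
      · omega
      · omega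
      · ext; omega
      · omega
      · omega
      · omega
      · have := congrArg Fin.val (ρ.injective (Fin.ext hij))
        dsimp only at this
        ext; omega))

section Glue

variable {k m n : ℕ} (h : k + 1 + m = n) (ρ : Equiv.Perm (Fin m))

lemma glue_of_lt {i : Fin n} (hi : (i : ℕ) < k) : (glue h ρ i : ℕ) = n - 2 - i := by
  simp [glue, hi]

lemma glue_of_eq {i : Fin n} (hi : (i : ℕ) = k) : (glue h ρ i : ℕ) = n - 1 := by
  simp [glue, hi]

lemma glue_of_gt {i : Fin n} (hi : k < (i : ℕ)) :
    (glue h ρ i : ℕ) = ρ ⟨i - (k + 1), by omega⟩ := by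
  simp [glue, hi.not_gt, hi.ne']

/-- The position in `glue h ρ` of the `i`-th entry of `ρ`. -/
def shift (i : Fin m) : Fin n := ⟨k + 1 + i, by omega⟩

lemma glue_shift (i : Fin m) : (glue h ρ (shift h i) : ℕ) = ρ i := by
  rw [glue_of_gt h ρ (by simp only [shift]; omega)]
  simp [shift]

lemma glue_injective : Function.Injective (glue h) := by
  intro ρ σ hρσ
  ext i
  rw [← glue_shift h ρ, ← glue_shift h σ, hρσ]

lemma atMostOneLarger_glue : AtMostOneLarger (glue h ρ) ↔ AtMostOneLarger ρ := by
  constructor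
  · intro H i j l hij hil h1 h2
    have := H (shift h i) (shift h j) (shift h l)
    simp only [Fin.lt_def, glue_shift, Fin.ext_iff] at this hij hil h1 h2 ⊢
    simp only [shift] at this
    have := this (by omega) (by omega) h1 h2
    omega
  · intro H i j l hij hil h1 h2
    rw [Fin.lt_def] at hij hil h1 h2
    have larger_eq : ∀ j : Fin n, (i : ℕ) < j → (glue h ρ i : ℕ) < glue h ρ j →
        (i : ℕ) ≤ k → (j : ℕ) = k := by
      intro j hij h1 hik
      rcases hik.lt_or_eq with hik | hik
      · rw [glue_of_lt h ρ hik] at h1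
        rcases lt_trichotomy (j : ℕ) k with hj | hj | hj
        · rw [glue_of_lt h ρ hj] at h1
          omega
        · exact hj
        · rw [glue_of_gt h ρ hj] at h1
          omega
      · rw [glue_of_eq h ρ hik] at h1
        omega
    by_cases hik : (i : ℕ) ≤ k
    · exact Fin.ext ((larger_eq j hij h1 hik).trans (larger_eq l hil h2 hik).symm)
    · rw [glue_of_gt h ρ (i := i) (by omega)] at h1 h2
      rw [glue_of_gt h ρ (by omega)] at h1 h2
      have := H _ _ _ (by rw [Fin.lt_def]; dsimp only; omega)
        (by rw [Fin.lt_def]; dsimp only; omega) h1 h2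
      rw [Fin.mk.injEq] at this
      ext; omega

lemma contains_glue_of_contains {p : ℕ} {σ : Equiv.Perm (Fin p)} (H : PContains ρ σ) :
    PContains (glue h ρ) σ := by
  obtain ⟨f, hf, hfσ⟩ := H
  refine ⟨fun i => shift h (f i), ?_, ?_⟩
  · intro i j hij
    have := hf hij
    simp only [shift, Fin.lt_def] at this ⊢
    omega
  · intro s t
    rw [← hfσ, Fin.lt_def, Fin.lt_def, glue_shift, glue_shift]

lemma contains_gamma_glue_of_inversion {b : ℕ} {γ : Equiv.Perm (Fin (b + 3))}
    (hγ : IsGamma b γ) (hbk : b ≤ k) {p q : Fin m} (hpq : p < q) (hρ : ρ q < ρ p) :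
    PContains (glue h ρ) γ := by
  rw [Fin.lt_def] at hpq hρ
  have val : ∀ s : Fin (b + 3), ∃ x : Fin n,
      ((s : ℕ) < b ∧ (x : ℕ) = s ∧ (glue h ρ x : ℕ) = n - 2 - s) ∨
      ((s : ℕ) = b ∧ (x : ℕ) = k ∧ (glue h ρ x : ℕ) = n - 1) ∨
      ((s : ℕ) = b + 1 ∧ (x : ℕ) = k + 1 + p ∧ (glue h ρ x : ℕ) = ρ p) ∨
      ((s : ℕ) = b + 2 ∧ (x : ℕ) = k + 1 + q ∧ (glue h ρ x : ℕ) = ρ q) := by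
    intro s
    by_cases h1 : (s : ℕ) < b
    · exact ⟨⟨s, by omega⟩, Or.inl ⟨h1, rfl, glue_of_lt h ρ (by dsimp only; omega)⟩⟩
    by_cases h2 : (s : ℕ) = b
    · exact ⟨⟨k, by omega⟩, Or.inr (Or.inl ⟨h2, rfl, glue_of_eq h ρ rfl⟩)⟩
    by_cases h3 : (s : ℕ) = b + 1
    · exact ⟨shift h p, Or.inr (Or.inr (Or.inl ⟨h3, rfl, glue_shift h ρ p⟩))⟩
    · exact ⟨shift h q, Or.inr (Or.inr (Or.inr ⟨by omega, rfl, glue_shift h ρ q⟩))⟩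
  choose f hf using val
  refine ⟨f, ?_, ?_⟩
  · intro s t hst
    have hs := hf s
    have ht := hf t
    rw [Fin.lt_def] at hst ⊢
    omega
  · intro s t
    have hs := hf s
    have ht := hf t
    have gs := hγ s
    have gt := hγ t
    rw [Fin.lt_def, Fin.lt_def]
    split_ifs at gs gt <;> omega

lemma contains_gamma_glue_iff {b : ℕ} (hb : 0 < b) {γ : Equiv.Perm (Fin (b + 3))}
    (hγ : IsGamma b γ) :
    PContains (glue h ρ) γ ↔
      PContains ρ γ ∨ (b ≤ k ∧ ∃ p q : Fin m, p < q ∧ ρ q < ρ p) := by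
  constructor
  · rintro ⟨f, hf, hfγ⟩
    have hγlt : ∀ s t : Fin (b + 3), (γ s : ℕ) < γ t → (glue h ρ (f s) : ℕ) < glue h ρ (f t) :=
      fun s t hst => (hfγ s t).2 hst
    have g0 : (γ ⟨0, by omega⟩ : ℕ) = b + 1 := by rw [hγ]; simp [hb]
    have gb : (γ ⟨b, by omega⟩ : ℕ) = b + 2 := by rw [hγ]; simp
    have gb1 : (γ ⟨b + 1, by omega⟩ : ℕ) = 1 := by rw [hγ]; simp
    have gb2 : (γ ⟨b + 2, by omega⟩ : ℕ) = 0 := by rw [hγ]; simp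
    have l0 := hγlt ⟨0, by omega⟩ ⟨b, by omega⟩ (by omega)
    have f0 : f ⟨0, by omega⟩ < f ⟨b, by omega⟩ := hf hb
    rw [Fin.lt_def] at f0
    rcases lt_trichotomy (f ⟨b, by omega⟩ : ℕ) k with hk | hk | hk
    · rw [glue_of_lt h ρ hk, glue_of_lt h ρ (by omega)] at l0
      omega
    · right
      have hbf : ∀ s (hs : s < b + 3), s ≤ f ⟨s, hs⟩ := by
        intro s
        induction s with
        | zero => simp
        | succ s ih =>
          intro hs
          have h1 := ih (by omega)
          have h2 : f ⟨s, by omega⟩ < f ⟨s + 1, hs⟩ := hf (by simp)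
          rw [Fin.lt_def] at h2
          omega
      refine ⟨hk ▸ hbf b (by omega), ?_⟩
      have f1 : f ⟨b, by omega⟩ < f ⟨b + 1, by omega⟩ := hf (by simp)
      have f2 : f ⟨b + 1, by omega⟩ < f ⟨b + 2, by omega⟩ := hf (by simp)
      rw [Fin.lt_def] at f1 f2
      have l1 := hγlt ⟨b + 2, by omega⟩ ⟨b + 1, by omega⟩ (by omega)
      rw [glue_of_gt h ρ (by omega), glue_of_gt h ρ (by omega)] at l1
      exact ⟨_, _, by rw [Fin.lt_def]; dsimp only; omega, l1⟩
    · left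
      have hfk : k < (f ⟨0, by omega⟩ : ℕ) := by
        by_contra hcon
        rw [glue_of_gt h ρ hk] at l0
        rcases (not_lt.1 hcon).lt_or_eq with h1 | h1
        · rw [glue_of_lt h ρ h1] at l0
          omega
        · rw [glue_of_eq h ρ h1] at l0
          omega
      have hall : ∀ s, k < (f s : ℕ) := by
        intro s
        have := hf.monotone (a := ⟨0, by omega⟩) (b := s) (by simp)
        rw [Fin.le_def] at this
        omega
      refine ⟨fun s => ⟨f s - (k + 1), by omega⟩, ?_, ?_⟩
      · intro s t hst
        have h1 := hf hst
        have h2 := hall s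
        rw [Fin.lt_def] at h1 ⊢
        dsimp only
        omega
      · intro s t
        rw [← hfγ, Fin.lt_def, Fin.lt_def, glue_of_gt h ρ (hall s), glue_of_gt h ρ (hall t)]
  · rintro (H | ⟨hbk, p, q, hpq, hρ⟩)
    · exact contains_glue_of_contains h ρ H
    · exact contains_gamma_glue_of_inversion h ρ hγ hbk hpq hρ

end Glue

lemma AtMostOneLarger.apply_of_lt {k n : ℕ} {π : Equiv.Perm (Fin n)} (H : AtMostOneLarger π)
    (hk : k < n) (hπ : (π ⟨k, hk⟩ : ℕ) = n - 1) (i : ℕ) (hi : i < k) :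
    (π ⟨i, hi.trans hk⟩ : ℕ) = n - 2 - i := by
  induction i using Nat.strong_induction_on with
  | _ i ih =>
    obtain ⟨⟨p, hp⟩, hpv⟩ := π.surjective ⟨n - 2 - i, by omega⟩
    have hpv := congrArg Fin.val hpv
    dsimp only at hpv
    have hpk : p ≠ k := by
      rintro rfl
      omega
    rcases lt_trichotomy p i with h | h | h
    · have := ih p h (h.trans hi)
      omega
    · subst h
      exact hpv
    · have hik : (π ⟨i, hi.trans hk⟩ : ℕ) ≠ n - 1 := by
        intro h1
        have := π.injective (Fin.ext (h1.trans hπ.symm))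
        rw [Fin.mk.injEq] at this
        omega
      have hle : (π ⟨p, hp⟩ : ℕ) ≤ π ⟨i, hi.trans hk⟩ := by
        by_contra! hcon
        have := H ⟨i, hi.trans hk⟩ ⟨k, hk⟩ ⟨p, hp⟩ hi h (by rw [Fin.lt_def]; omega) hcon
        rw [Fin.mk.injEq] at this
        exact hpk this.symm
      by_contra hne
      have hv := (π ⟨i, hi.trans hk⟩).isLt
      have h1 := ih (n - 2 - π ⟨i, hi.trans hk⟩) (by omega) (by omega)
      have := π.injective (Fin.ext (h1.trans (b := n - 2 - (n - 2 - π ⟨i, hi.trans hk⟩))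
        (c := (π ⟨i, hi.trans hk⟩ : ℕ)) (by omega)))
      rw [Fin.mk.injEq] at this
      omega

lemma AtMostOneLarger.exists_glue {k m n : ℕ} (h : k + 1 + m = n) {π : Equiv.Perm (Fin n)}
    (H : AtMostOneLarger π) (hπ : (π ⟨k, by omega⟩ : ℕ) = n - 1) :
    ∃ ρ : Equiv.Perm (Fin m), glue h ρ = π := by
  have hlt : ∀ i : Fin n, k < (i : ℕ) → (π i : ℕ) < m := by
    intro i hi
    by_contra! hm
    have hv := (π i).isLt
    by_cases hlast : (π i : ℕ) = n - 1
    · have := congrArg Fin.val (π.injective (Fin.ext (hlast.trans hπ.symm)))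
      dsimp only at this
      omega
    · have h1 := H.apply_of_lt (by omega) hπ (n - 2 - π i) (by omega)
      have := congrArg Fin.val (π.injective (Fin.ext
        (h1.trans (b := n - 2 - (n - 2 - π i)) (c := (π i : ℕ)) (by omega))))
      dsimp only at this
      omega
  let g : Fin m → Fin m := fun i =>
    ⟨π (shift h i), hlt _ (by simp only [shift]; omega)⟩
  have hg : Function.Injective g := by
    intro i j hij
    have := π.injective (Fin.ext (Fin.mk.inj hij))
    simp only [shift, Fin.mk.injEq] at this
    ext; omega
  refine ⟨Equiv.ofBijective g (Finite.injective_iff_bijective.1 hg), ?_⟩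
  ext i
  rcases lt_trichotomy (i : ℕ) k with hi | hi | hi
  · rw [glue_of_lt h _ hi, ← H.apply_of_lt (by omega) hπ i hi]
  · rw [glue_of_eq h _ hi, ← hπ]
    congr 2
    exact Fin.ext hi.symm
  · rw [glue_of_gt h _ hi, Equiv.ofBijective_apply]
    change (π (shift h _) : ℕ) = _
    congr 2
    ext
    simp only [shift]
    omega

/-- The permutations of size `n` counted by the theorem. -/
def IsGood {b : ℕ} (γ : Equiv.Perm (Fin (b + 3))) {n : ℕ} (π : Equiv.Perm (Fin n)) : Prop :=
  AtMostOneLarger π ∧ PAvoids π γ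

lemma avoids_of_lt {n p : ℕ} (hnp : n < p) (π : Equiv.Perm (Fin n)) (σ : Equiv.Perm (Fin p)) :
    PAvoids π σ := by
  rintro ⟨f, hf, -⟩
  have := Fintype.card_le_of_injective f hf.injective
  simp only [Fintype.card_fin] at this
  omega

lemma isGood_glue_iff {b k m n : ℕ} (hb : 0 < b) {γ : Equiv.Perm (Fin (b + 3))}
    (hγ : IsGamma b γ) (h : k + 1 + m = n) (ρ : Equiv.Perm (Fin m)) :
    IsGood γ (glue h ρ) ↔ IsGood γ ρ ∧ (b ≤ k → ∀ p q : Fin m, p < q → ρ p ≤ ρ q) := by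
  unfold IsGood PAvoids
  rw [atMostOneLarger_glue, contains_gamma_glue_iff h ρ hb hγ]
  push Not
  tauto

lemma eq_one_of_no_inversion {m : ℕ} {ρ : Equiv.Perm (Fin m)}
    (hρ : ∀ p q : Fin m, p < q → ρ p ≤ ρ q) : ρ = 1 := by
  have hmono : StrictMono ρ := fun p q hpq =>
    lt_of_le_of_ne (hρ p q hpq) (fun h => hpq.ne (ρ.injective h))
  have hid : (hmono.orderIsoOfSurjective ρ ρ.surjective) = OrderIso.refl _ :=
    Subsingleton.elim _ _
  ext i
  exact congrArg Fin.val (congrFun (congrArg DFunLike.coe hid) i)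

lemma isGood_one {b m : ℕ} (γ : Equiv.Perm (Fin (b + 3))) (hm : m ≤ 2) :
    IsGood γ (1 : Equiv.Perm (Fin m)) := by
  refine ⟨?_, avoids_of_lt (by omega) _ _⟩
  intro i j l hij hil _ _
  ext
  rw [Fin.lt_def] at hij hil
  omega

lemma le_two_of_isGood_one {b m : ℕ} {γ : Equiv.Perm (Fin (b + 3))}
    (H : IsGood γ (1 : Equiv.Perm (Fin m))) : m ≤ 2 := by
  by_contra! hm
  have := H.1 ⟨0, by omega⟩ ⟨1, by omega⟩ ⟨2, by omega⟩ (by simp) (by simp) (by simp) (by simp)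
  simp at this

/-- The number of permutations of size `n` counted by the theorem. -/
noncomputable def goodCard {b : ℕ} (γ : Equiv.Perm (Fin (b + 3))) (n : ℕ) : ℕ :=
  Nat.card {π : Equiv.Perm (Fin n) // IsGood γ π}

lemma card_fiber {b k m n : ℕ} (hb : 0 < b) {γ : Equiv.Perm (Fin (b + 3))}
    (hγ : IsGamma b γ) (h : k + 1 + m = n) :
    Nat.card {π : Equiv.Perm (Fin n) // IsGood γ π ∧ (π ⟨k, by omega⟩ : ℕ) = n - 1} =
      if k < b then goodCard γ m else if m ≤ 2 then 1 else 0 := by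
  have hcard : Nat.card {ρ : Equiv.Perm (Fin m) //
        IsGood γ ρ ∧ (b ≤ k → ∀ p q : Fin m, p < q → ρ p ≤ ρ q)} =
      Nat.card {π : Equiv.Perm (Fin n) // IsGood γ π ∧ (π ⟨k, by omega⟩ : ℕ) = n - 1} := by
    refine Nat.card_congr (Equiv.ofBijective
      (fun ρ => ⟨glue h ρ.1, (isGood_glue_iff hb hγ h ρ.1).2 ρ.2, glue_of_eq h ρ.1 rfl⟩) ⟨?_, ?_⟩)
    · intro ρ σ hρσ
      exact Subtype.ext (glue_injective h (congrArg Subtype.val hρσ))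
    · rintro ⟨π, hπ, hk⟩
      obtain ⟨ρ, rfl⟩ := hπ.1.exists_glue h hk
      exact ⟨⟨ρ, (isGood_glue_iff hb hγ h ρ).1 hπ⟩, rfl⟩
  rw [← hcard]
  split_ifs with hk hm
  · exact Nat.card_congr (Equiv.subtypeEquivRight fun ρ => by
      simp [hk.not_ge])
  · rw [Nat.card_eq_one_iff_unique]
    refine ⟨⟨fun ρ σ => Subtype.ext ?_⟩, ⟨⟨1, isGood_one γ hm, ?_⟩⟩⟩
    · rw [eq_one_of_no_inversion (ρ.2.2 (not_lt.1 hk)),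
        eq_one_of_no_inversion (σ.2.2 (not_lt.1 hk))]
    · exact fun _ p q hpq => hpq.le
  · rw [Nat.card_eq_zero]
    left
    refine ⟨fun ⟨ρ, hρ, hinv⟩ => hm ?_⟩
    obtain rfl := eq_one_of_no_inversion (hinv (not_lt.1 hk))
    exact le_two_of_isGood_one hρ

lemma goodCard_zero {b : ℕ} (γ : Equiv.Perm (Fin (b + 3))) : goodCard γ 0 = 1 := by
  rw [goodCard, Nat.card_eq_one_iff_unique]
  exact ⟨inferInstance, ⟨⟨1, fun i => i.elim0, avoids_of_lt (by omega) _ _⟩⟩⟩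

lemma goodCard_succ {b : ℕ} (hb : 0 < b) {γ : Equiv.Perm (Fin (b + 3))}
    (hγ : IsGamma b γ) (n : ℕ) :
    goodCard γ (n + 1) = ∑ k ∈ Finset.range (n + 1),
      if k < b then goodCard γ (n - k) else if n - k ≤ 2 then 1 else 0 := by
  let pos : {π : Equiv.Perm (Fin (n + 1)) // IsGood γ π} → Fin (n + 1) :=
    fun π => π.1.symm (Fin.last n)
  rw [goodCard, Nat.card_congr (Equiv.sigmaFiberEquiv pos).symm, Nat.card_sigma,
    ← Fin.sum_univ_eq_sum_range
      (fun k => if k < b then goodCard γ (n - k) else if n - k ≤ 2 then 1 else 0)]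
  refine Finset.sum_congr rfl fun k _ => ?_
  rw [← card_fiber (n := n + 1) hb hγ (by omega : (k : ℕ) + 1 + (n - k) = n + 1)]
  refine Nat.card_congr ((Equiv.subtypeSubtypeEquivSubtypeInter _
    (fun π : Equiv.Perm (Fin (n + 1)) => π.symm (Fin.last n) = k)).trans
    (Equiv.subtypeEquivRight fun π => and_congr_right fun _ => ?_))
  rw [Equiv.symm_apply_eq, eq_comm, Fin.ext_iff]
  rfl

/-- Partial sums of the generalized Fibonacci numbers. -/
def genFibSum (b m : ℕ) : ℕ := ∑ k ∈ Finset.Icc 1 m, genFib b k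

lemma genFibSum_zero (b : ℕ) : genFibSum b 0 = 0 := by simp [genFibSum]

lemma genFibSum_succ (b m : ℕ) : genFibSum b (m + 1) = genFibSum b m + genFib b (m + 1) := by
  rw [genFibSum, Finset.sum_Icc_succ_top (by omega), genFibSum]

lemma genFibSum_eq_pred (b m : ℕ) : genFibSum b m = genFibSum b (m - 1) + genFib b m := by
  cases m with
  | zero => simp [genFib]
  | succ m => exact genFibSum_succ b m

lemma genFibSum_succ_eq_sum (b m : ℕ) :
    genFibSum b (m + 1) = 1 + ∑ i ∈ Finset.range b, genFibSum b (m - i) := by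
  induction m with
  | zero => simp [genFibSum, genFib]
  | succ m ih =>
    rw [genFibSum_succ, ih, genFib, add_assoc, ← Finset.sum_add_distrib]
    congr 1
    refine Finset.sum_congr rfl fun i _ => ?_
    rw [genFibSum_eq_pred b (m + 1 - i), show m + 1 - i - 1 = m - i by omega]

/-- The closed form of the theorem, for all `n` up to a correction at `n ≤ 2`. -/
def closedForm (b n : ℕ) : ℕ := genFibSum b (n - 1) + 2 * genFibSum b (n - 2)

lemma closedForm_recurrence (b n : ℕ) :
    closedForm b (n + 3) = 3 + ∑ i ∈ Finset.range b, closedForm b (n + 2 - i) := by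
  simp only [closedForm, Finset.sum_add_distrib, ← Finset.mul_sum]
  rw [show n + 3 - 1 = n + 1 + 1 by omega, show n + 3 - 2 = n + 1 by omega,
    genFibSum_succ_eq_sum b (n + 1), genFibSum_succ_eq_sum b n]
  have h1 : ∀ i, n + 2 - i - 1 = n + 1 - i := fun i => by omega
  have h2 : ∀ i, n + 2 - i - 2 = n - i := fun i => by omega
  simp only [h1, h2]
  ring

lemma sum_range_le_two (n : ℕ) :
    ∑ k ∈ Finset.range (n + 3), (if n + 2 - k ≤ 2 then 1 else 0) = 3 := by
  have := Finset.sum_range_reflect (fun j => if j ≤ 2 then 1 else 0) (n + 3)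
  rw [show n + 3 - 1 = n + 2 by omega] at this
  rw [this, add_comm n 3, Finset.sum_range_add]
  rw [Finset.sum_eq_zero (s := Finset.range n) fun k _ => if_neg (by omega)]
  rfl

lemma goodCard_eq {b : ℕ} (hb : 2 ≤ b) {γ : Equiv.Perm (Fin (b + 3))}
    (hγ : IsGamma b γ) (n : ℕ) :
    goodCard γ n = closedForm b n + if n ≤ 2 then 1 else 0 := by
  have hb0 : 0 < b := by omega
  induction n using Nat.strong_induction_on with
  | _ n ih =>
    match n, ih with
    | 0, _ => simp [goodCard_zero, closedForm, genFibSum_zero]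
    | 1, _ => simp [goodCard_succ hb0 hγ, goodCard_zero, closedForm, genFibSum_zero]
    | 2, ih =>
      have h1 := ih 1 (by omega)
      simp [goodCard_succ hb0 hγ 1, Finset.sum_range_succ, h1, goodCard_zero, closedForm,
        genFibSum, genFib, hb0, show 1 < b by omega]
    | n + 3, ih =>
      have hstep : ∀ k ∈ Finset.range (n + 3),
          (if k < b then goodCard γ (n + 2 - k) else if n + 2 - k ≤ 2 then 1 else 0) =
            (if k < b then closedForm b (n + 2 - k) else 0) +
              if n + 2 - k ≤ 2 then 1 else 0 := by
        intro k _
        rw [ih (n + 2 - k) (by omega)]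
        split_ifs <;> simp
      have hsum : ∑ k ∈ Finset.range (n + 3), (if k < b then closedForm b (n + 2 - k) else 0) =
          ∑ k ∈ Finset.range b, closedForm b (n + 2 - k) := by
        rw [← Finset.sum_filter]
        refine Finset.sum_subset_zero_on_sdiff ?_ ?_ fun _ _ => rfl
        · intro k hk
          simp_all
        · intro k hk
          simp only [Finset.mem_sdiff, Finset.mem_filter, Finset.mem_range] at hk
          rw [show n + 2 - k = 0 by omega]
          simp [closedForm, genFibSum_zero]
      rw [goodCard_succ hb0 hγ (n + 2), Finset.sum_congr rfl hstep, Finset.sum_add_distrib, hsum,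
        sum_range_le_two, closedForm_recurrence]
      simp [add_comm]

/-- Let `γ = γ_{0,b,2}` be the permutation of `{1,…,b+3}` with one-line notation
`b+2, b+1, …, 4, 3, b+3, 2, 1` (zero-indexed: `γ i = b + 1 - i` for `i < b`,
`γ b = b + 2`, `γ (b+1) = 1`, `γ (b+2) = 0`).  Then for `b ≥ 3` and `n ≥ 3`,
`|S_n(132, 123, γ_{0,b,2})| = ∑_{k=1}^{n-1} F_{b,k} + 2 ∑_{k=1}^{n-2} F_{b,k}`. -/
theorem statement8 (b n : ℕ) (hb : 3 ≤ b) (hn : 3 ≤ n)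
    (γ : Equiv.Perm (Fin (b + 3)))
    (hγ : ∀ i : Fin (b + 3),
      (γ i : ℕ) = if (i : ℕ) < b then b + 1 - (i : ℕ)
        else if (i : ℕ) = b then b + 2 else b + 2 - (i : ℕ)) :
    Nat.card {π : Equiv.Perm (Fin n) //
        PAvoids π p132 ∧ PAvoids π p123 ∧ PAvoids π γ} =
      (∑ k ∈ Finset.Icc 1 (n - 1), genFib b k) +
        2 * ∑ k ∈ Finset.Icc 1 (n - 2), genFib b k := by
  have hset : ∀ π : Equiv.Perm (Fin n),
      PAvoids π p132 ∧ PAvoids π p123 ∧ PAvoids π γ ↔ IsGood γ π := fun π => by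
    rw [← and_assoc, avoids_p132_p123_iff, IsGood]
  rw [Nat.card_congr (Equiv.subtypeEquivRight hset)]
  have := goodCard_eq (by omega) hγ n
  rwa [if_neg (by omega), add_zero] at this
end

section
/- Let ω_4 be the permutation of {1,…,4} whose one-line notation is 4, 2, 1, 3. Then for all n ≥ 1, |S_n(132, 2341, ω_4)| = F_{n+5} − C(n+1, 2) − 2·C(n+1, 1) − 2, where F_m denotes the m-th Fibonacci number and C(a,b) denotes the binomial coefficient. -/
/-- The pattern 2341 (zero-indexed `1,2,3,0`). -/
noncomputable def p2341 : Equiv.Perm (Fin 4) := Equiv.ofBijective ![1, 2, 3, 0] (by decide)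

/-- The pattern `ω_4` with one-line notation `4,2,1,3` (zero-indexed `3,1,0,2`). -/
noncomputable def w4 : Equiv.Perm (Fin 4) := Equiv.ofBijective ![3, 1, 0, 2] (by decide)

namespace List

/-- No three entries of the list form the pattern 132. -/
def Avoids132 (l : List ℕ) : Prop := ∀ a b c, [a, b, c] <+ l → ¬(a < c ∧ c < b)

/-- No three entries of the list form the pattern 213. -/
def Avoids213 (l : List ℕ) : Prop := ∀ a b c, [a, b, c] <+ l → ¬(b < a ∧ a < c)

/-- No four entries of the list form the pattern 2341. -/
def Avoids2341 (l : List ℕ) : Prop :=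
  ∀ a b c d, [a, b, c, d] <+ l → ¬(d < a ∧ a < b ∧ b < c)

/-- No four entries of the list form the pattern 4213. -/
def Avoids4213 (l : List ℕ) : Prop :=
  ∀ a b c d, [a, b, c, d] <+ l → ¬(c < b ∧ b < d ∧ d < a)

section Sublist

variable {α : Type*} {X Y : List α} {a b c d : α}

theorem triple_sublist_append :
    [a, b, c] <+ X ++ Y ↔
      [a, b, c] <+ X ∨ ([a, b] <+ X ∧ c ∈ Y) ∨ (a ∈ X ∧ [b, c] <+ Y) ∨ [a, b, c] <+ Y := by
  rw [sublist_append_iff]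
  constructor
  · rintro ⟨l₁, l₂, h, h₁, h₂⟩
    rcases l₁ with _ | ⟨_, _ | ⟨_, _ | ⟨_, _ | ⟨_, _⟩⟩⟩⟩ <;> simp_all
    obtain ⟨rfl, rfl, rfl⟩ := h
    simp_all
  · rintro (h | ⟨h₁, h₂⟩ | ⟨h₁, h₂⟩ | h)
    · exact ⟨[a, b, c], [], by simp_all⟩
    · exact ⟨[a, b], [c], by simp_all⟩
    · exact ⟨[a], [b, c], by simp_all⟩
    · exact ⟨[], [a, b, c], by simp_all⟩

theorem quadruple_sublist_append :
    [a, b, c, d] <+ X ++ Y ↔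
      [a, b, c, d] <+ X ∨ ([a, b, c] <+ X ∧ d ∈ Y) ∨ ([a, b] <+ X ∧ [c, d] <+ Y) ∨
        (a ∈ X ∧ [b, c, d] <+ Y) ∨ [a, b, c, d] <+ Y := by
  rw [sublist_append_iff]
  constructor
  · rintro ⟨l₁, l₂, h, h₁, h₂⟩
    rcases l₁ with _ | ⟨_, _ | ⟨_, _ | ⟨_, _ | ⟨_, _ | ⟨_, _⟩⟩⟩⟩⟩ <;> simp_all
    obtain ⟨rfl, rfl, rfl, rfl⟩ := h
    simp_all
  · rintro (h | ⟨h₁, h₂⟩ | ⟨h₁, h₂⟩ | ⟨h₁, h₂⟩ | h)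
    · exact ⟨[a, b, c, d], [], by simp_all⟩
    · exact ⟨[a, b, c], [d], by simp_all⟩
    · exact ⟨[a, b], [c, d], by simp_all⟩
    · exact ⟨[a], [b, c, d], by simp_all⟩
    · exact ⟨[], [a, b, c, d], by simp_all⟩

end Sublist

section Mono

variable {l l' : List ℕ}

theorem Avoids132.of_sublist (h : Avoids132 l) (hs : l' <+ l) : Avoids132 l' :=
  fun a b c h' => h a b c (h'.trans hs)

theorem Avoids213.of_sublist (h : Avoids213 l) (hs : l' <+ l) : Avoids213 l' :=
  fun a b c h' => h a b c (h'.trans hs)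

theorem Avoids2341.of_sublist (h : Avoids2341 l) (hs : l' <+ l) : Avoids2341 l' :=
  fun a b c d h' => h a b c d (h'.trans hs)

theorem Avoids4213.of_sublist (h : Avoids4213 l) (hs : l' <+ l) : Avoids4213 l' :=
  fun a b c d h' => h a b c d (h'.trans hs)

theorem Avoids132.of_pairwise_lt (h : l.Pairwise (· < ·)) : Avoids132 l := by
  intro a b c hs
  have := h.sublist hs
  simp at this
  omega

theorem Avoids213.of_pairwise_lt (h : l.Pairwise (· < ·)) : Avoids213 l := by
  intro a b c hs
  have := h.sublist hs
  simp at this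
  omega

theorem Avoids2341.of_pairwise_lt (h : l.Pairwise (· < ·)) : Avoids2341 l := by
  intro a b c d hs
  have := h.sublist hs
  simp at this
  omega

theorem Avoids132.of_pairwise_gt (h : l.Pairwise (· > ·)) : Avoids132 l := by
  intro a b c hs
  have := h.sublist hs
  simp at this
  omega

theorem Avoids2341.of_pairwise_gt (h : l.Pairwise (· > ·)) : Avoids2341 l := by
  intro a b c d hs
  have := h.sublist hs
  simp at this
  omega

theorem Avoids4213.of_pairwise_gt (h : l.Pairwise (· > ·)) : Avoids4213 l := by
  intro a b c d hs
  have := h.sublist hs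
  simp at this
  omega

end Mono

section Append

variable {L R : List ℕ} {n : ℕ}

theorem avoids132_append_cons_iff (hL : ∀ x ∈ L, x < n) (hR : ∀ x ∈ R, x < n)
    (hLR : ∀ x ∈ L, ∀ y ∈ R, y < x) :
    Avoids132 (L ++ n :: R) ↔ Avoids132 L ∧ Avoids132 R := by
  refine ⟨fun h => ⟨h.of_sublist (by simp), h.of_sublist (by simp)⟩, fun ⟨h₁, h₂⟩ a b c hs => ?_⟩
  simp only [triple_sublist_append, cons_sublist_cons', singleton_sublist, mem_cons] at hs
  rcases hs with hs | ⟨hs, hs'⟩ | ⟨hs, hs'⟩ | hs | ⟨rfl, hs⟩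
  · exact h₁ a b c hs
  · have := hL _ (hs.subset (by simp : a ∈ _)); have := hL _ (hs.subset (by simp : b ∈ _))
    have := hLR _ (hs.subset (by simp : a ∈ _)) c
    grind
  · have := hLR _ hs c
    have := hs'.elim (fun h => h.subset (by simp : c ∈ _)) (·.2)
    grind
  · exact h₂ a b c hs
  · have := hR c (hs.subset (by simp)); omega

theorem avoids213_append_cons_iff (hL : ∀ x ∈ L, x < n) (hR : ∀ x ∈ R, x < n)
    (hLR : ∀ x ∈ L, ∀ y ∈ R, y < x) (hd : L.Nodup) :
    Avoids213 (L ++ n :: R) ↔ L.Pairwise (· < ·) ∧ Avoids213 R := by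
  constructor
  · refine fun h => ⟨pairwise_iff_forall_sublist.2 fun {a b} hs => ?_, h.of_sublist (by simp)⟩
    have := h a b n (triple_sublist_append.2 (.inr (.inl ⟨hs, by simp⟩)))
    have := hL a (hs.subset (by simp))
    have := hd.sublist hs
    simp at this
    omega
  · intro ⟨h₁, h₂⟩ a b c hs
    simp only [triple_sublist_append, cons_sublist_cons', singleton_sublist, mem_cons] at hs
    rcases hs with hs | ⟨hs, hs'⟩ | ⟨hs, hs'⟩ | hs | ⟨rfl, hs⟩
    · exact Avoids213.of_pairwise_lt h₁ a b c hs
    · have := h₁.sublist hs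
      simp at this
      omega
    · have := hLR _ hs c
      have := hL _ hs
      have := hs'.elim (fun h => h.subset (by simp : c ∈ _)) (·.2)
      grind
    · exact h₂ a b c hs
    · have := hR c (hs.subset (by simp)); omega

theorem avoids2341_append_cons_iff (hL : ∀ x ∈ L, x < n) (hR : ∀ x ∈ R, x < n)
    (hLR : ∀ x ∈ L, ∀ y ∈ R, y < x) (hd : L.Nodup) :
    Avoids2341 (L ++ n :: R) ↔
      Avoids2341 L ∧ Avoids2341 R ∧ (R = [] ∨ L.Pairwise (· > ·)) := by
  constructor
  · refine fun h => ⟨h.of_sublist (by simp), h.of_sublist (by simp), ?_⟩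
    refine or_iff_not_imp_left.2 fun hne => pairwise_iff_forall_sublist.2 fun {a b} hs => ?_
    obtain ⟨d, hdR⟩ := exists_mem_of_ne_nil R hne
    have := h a b n d (quadruple_sublist_append.2 (.inr (.inr (.inl ⟨hs, by simpa using hdR⟩))))
    have := hL b (hs.subset (by simp))
    have := hLR a (hs.subset (by simp)) d hdR
    have := hd.sublist hs
    simp at this
    omega
  · intro ⟨h₁, h₂, h₃⟩ a b c d hs
    simp only [quadruple_sublist_append, cons_sublist_cons', singleton_sublist, mem_cons] at hs
    rcases hs with hs | ⟨hs, hs'⟩ | ⟨hs, hs'⟩ | ⟨hs, hs'⟩ | hs | ⟨rfl, hs⟩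
    · exact h₁ a b c d hs
    · rcases h₃ with rfl | h₃
      · have := hL _ (hs.subset (by simp : a ∈ _))
        simp at hs'
        omega
      · have := h₃.sublist hs
        simp at this
        omega
    · rcases h₃ with rfl | h₃
      · simp at hs'
      · have := h₃.sublist hs
        simp at this
        omega
    · have h₄ : c ∈ R := hs'.elim (fun h => h.subset (by simp)) (fun h => h.2.subset (by simp))
      have := hLR _ hs _ h₄
      have h₅ : d ∈ R := hs'.elim (fun h => h.subset (by simp)) (fun h => h.2.subset (by simp))
      omega
    · exact h₂ a b c d hs
    · have := hR b (hs.subset (by simp)); omega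

theorem avoids4213_append_cons_iff (hL : ∀ x ∈ L, x < n) (hR : ∀ x ∈ R, x < n)
    (hLR : ∀ x ∈ L, ∀ y ∈ R, y < x) :
    Avoids4213 (L ++ n :: R) ↔ Avoids4213 L ∧ Avoids213 R := by
  constructor
  · refine fun h => ⟨h.of_sublist (by simp), fun a b c hs ⟨h₁, h₂⟩ => ?_⟩
    refine h n a b c (quadruple_sublist_append.2 ?_) ⟨h₁, h₂, hR c (hs.subset (by simp))⟩
    simp [hs]
  · intro ⟨h₁, h₂⟩ a b c d hs
    simp only [quadruple_sublist_append, cons_sublist_cons', singleton_sublist, mem_cons] at hs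
    rcases hs with hs | ⟨hs, hs'⟩ | ⟨hs, hs'⟩ | ⟨hs, hs'⟩ | hs | ⟨rfl, hs⟩
    · exact h₁ a b c d hs
    · have := hLR a (hs.subset (by simp)) d
      have := hLR b (hs.subset (by simp)) d
      have := hL a (hs.subset (by simp))
      grind
    · have := hs'.elim (fun h => h.subset (by simp : d ∈ _)) (·.2)
      have := hLR b (hs.subset (by simp)) d
      grind
    · rcases hs' with hs' | ⟨rfl, hs'⟩
      · have := h₂ b c d hs'
        omega
      · have := hR d (hs'.subset (by simp)); omega
    · have := h₂ b c d ((sublist_cons_self a _).trans hs)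
      omega
    · have := h₂ b c d hs
      omega

end Append

theorem perm_range_of_append {L R : List ℕ} {n : ℕ} (h : L ++ R ~ range n)
    (hLR : ∀ x ∈ L, ∀ y ∈ R, y < x) :
    ∃ r k, r + k = n ∧ R ~ range r ∧ L ~ range' r k := by
  have hp := perm_insertionSort (· ≤ ·) R
  have hq := perm_insertionSort (· ≤ ·) L
  have hs : insertionSort (· ≤ ·) R ++ insertionSort (· ≤ ·) L = range n := by
    refine Perm.eq_of_pairwise (le := (· ≤ ·)) (fun a b _ _ => le_antisymm) ?_ pairwise_le_range
      ((hp.append hq).trans (perm_append_comm.trans h))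
    refine pairwise_append.2 ⟨pairwise_insertionSort _ _, pairwise_insertionSort _ _, ?_⟩
    exact fun x hx y hy => (hLR y (hq.subset hy) x (hp.subset hx)).le
  have hlen : R.length + L.length = n := by
    have := h.length_eq
    simp at this
    omega
  rw [← hlen, range_eq_range', ← range'_append] at hs
  obtain ⟨h₁, h₂⟩ := append_inj hs (by simp)
  refine ⟨R.length, L.length, hlen, ?_, ?_⟩
  · rw [range_eq_range', ← h₁]
    exact hp.symm
  · rw [← show _ = range' R.length L.length by simpa using h₂]
    exact hq.symm

theorem exists_of_avoids132 {l : List ℕ} {n : ℕ} (h : l ~ range (n + 1)) (ha : Avoids132 l) :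
    ∃ L R r k, r + k = n ∧ R ~ range r ∧ L ~ range' r k ∧ l = L ++ n :: R := by
  obtain ⟨L, R, rfl⟩ := append_of_mem (h.symm.subset (by simp : n ∈ _))
  have hp : L ++ R ~ range n := by
    rw [range_succ] at h
    exact (perm_cons n).1 (perm_middle.symm.trans (h.trans (perm_append_singleton n _)))
  obtain ⟨r, k, hrk, hR, hL⟩ := perm_range_of_append hp fun x hx y hy => by
    have := ha x n y (triple_sublist_append.2 (.inr (.inr (.inl ⟨hx, by simpa using hy⟩))))
    have hyn : y < n := by simpa using hp.subset (mem_append_right L hy)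
    have hd := (nodup_append.1 (hp.nodup_iff.2 nodup_range)).2.2 x hx y hy
    omega
  exact ⟨L, R, r, k, hrk, hR, hL, rfl⟩

theorem perm_range_append_cons {L R : List ℕ} {r k : ℕ} (hR : R ~ range r) (hL : L ~ range' r k) :
    L ++ (r + k) :: R ~ range (r + k + 1) := by
  rw [range_succ]
  refine perm_middle.trans (Perm.trans ?_ (perm_append_singleton _ _).symm)
  refine (perm_cons _).2 (perm_append_comm.trans ((hR.append hL).trans ?_))
  rw [range_eq_range', range_eq_range', ← range'_append]
  simp

/-- The permutations of `0, …, n - 1`, `n ≠ 0`, avoiding 132, 213 and 2341. -/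
def avoiders132_213_2341 : ℕ → Finset (List ℕ)
  | 0 => ∅
  | 1 => {[0]}
  | r + 2 => insert (range (r + 2)) ((avoiders132_213_2341 (r + 1)).image (fun R => (r + 1) :: R) ∪
      (avoiders132_213_2341 r).image (fun R => r :: (r + 1) :: R))

/-- The permutations of `0, …, n - 1` avoiding 132, 2341 and 4213. -/
def avoiders132_2341_4213 : ℕ → Finset (List ℕ)
  | 0 => {[]}
  | n + 1 => (avoiders132_2341_4213 n).image (fun L => L ++ [n]) ∪
      (Finset.range (n + 1)).biUnion fun r =>
        (avoiders132_213_2341 r).image fun R => (range' r (n - r)).reverse ++ n :: R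

theorem blocks_bounds {L R : List ℕ} {r k : ℕ} (hR : R ~ range r) (hL : L ~ range' r k) :
    (∀ x ∈ L, x < r + k) ∧ (∀ x ∈ R, x < r + k) ∧ (∀ x ∈ L, ∀ y ∈ R, y < x) ∧ L.Nodup := by
  have h₁ : ∀ x ∈ L, r ≤ x ∧ x < r + k := fun x hx => by simpa using hL.subset hx
  have h₂ : ∀ x ∈ R, x < r := fun x hx => by simpa using hR.subset hx
  refine ⟨fun x hx => (h₁ x hx).2, fun x hx => (h₂ x hx).trans_le (by omega),
    fun x hx y hy => (h₂ y hy).trans_le (h₁ x hx).1, hL.nodup_iff.2 nodup_range'⟩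

theorem mem_avoiders132_213_2341 (n : ℕ) (l : List ℕ) :
    l ∈ avoiders132_213_2341 n ↔
      n ≠ 0 ∧ l ~ range n ∧ Avoids132 l ∧ Avoids213 l ∧ Avoids2341 l := by
  have hsorted (m : ℕ) : range m ~ range m ∧ Avoids132 (range m) ∧ Avoids213 (range m) ∧
      Avoids2341 (range m) :=
    ⟨.refl _, .of_pairwise_lt pairwise_lt_range, .of_pairwise_lt pairwise_lt_range,
      .of_pairwise_lt pairwise_lt_range⟩
  induction n using avoiders132_213_2341.induct generalizing l with
  | case1 => simp [avoiders132_213_2341]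
  | case2 =>
    simp only [avoiders132_213_2341, Finset.mem_singleton]
    constructor
    · rintro rfl
      exact ⟨one_ne_zero, hsorted 1⟩
    · rintro ⟨-, h, -⟩
      simpa using h
  | case3 r ih₁ ih₂ =>
    simp only [avoiders132_213_2341, Finset.mem_insert, Finset.mem_union, Finset.mem_image]
    constructor
    · rintro (rfl | ⟨R, hR, rfl⟩ | ⟨R, hR, rfl⟩)
      · exact ⟨by omega, hsorted _⟩
      · obtain ⟨-, hp, h₁, h₂, h₃⟩ := (ih₁ _).1 hR
        have hL : ([] : List ℕ) ~ range' (r + 1) 0 := by simp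
        obtain ⟨b₁, b₂, b₃, b₄⟩ := blocks_bounds hp hL
        exact ⟨by omega, perm_range_append_cons hp hL,
          (avoids132_append_cons_iff b₁ b₂ b₃).2 ⟨.of_pairwise_lt .nil, h₁⟩,
          (avoids213_append_cons_iff b₁ b₂ b₃ b₄).2 ⟨.nil, h₂⟩,
          (avoids2341_append_cons_iff b₁ b₂ b₃ b₄).2 ⟨.of_pairwise_lt .nil, h₃, .inr .nil⟩⟩
      · obtain ⟨-, hp, h₁, h₂, h₃⟩ := (ih₂ _).1 hR
        have hL : [r] ~ range' r 1 := by simp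
        obtain ⟨b₁, b₂, b₃, b₄⟩ := blocks_bounds hp hL
        exact ⟨by omega, perm_range_append_cons hp hL,
          (avoids132_append_cons_iff b₁ b₂ b₃).2 ⟨.of_pairwise_lt (pairwise_singleton _ _), h₁⟩,
          (avoids213_append_cons_iff b₁ b₂ b₃ b₄).2 ⟨pairwise_singleton _ _, h₂⟩,
          (avoids2341_append_cons_iff b₁ b₂ b₃ b₄).2
            ⟨.of_pairwise_lt (pairwise_singleton _ _), h₃, .inr (pairwise_singleton _ _)⟩⟩
    · rintro ⟨-, hp, h₁, h₂, h₃⟩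
      obtain ⟨L, R, s, k, hsk, hR, hL, rfl⟩ := exists_of_avoids132 hp h₁
      obtain ⟨b₁, b₂, b₃, b₄⟩ := blocks_bounds hR hL
      rw [hsk] at b₁ b₂
      obtain ⟨-, hR₁⟩ := (avoids132_append_cons_iff b₁ b₂ b₃).1 h₁
      obtain ⟨hinc, hR₂⟩ := (avoids213_append_cons_iff b₁ b₂ b₃ b₄).1 h₂
      obtain ⟨-, hR₃, h₄⟩ := (avoids2341_append_cons_iff b₁ b₂ b₃ b₄).1 h₃
      have hLeq : L = range' s k := Perm.eq_of_pairwise (le := (· < ·))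
        (fun a b _ _ h h' => absurd h h'.asymm) hinc (pairwise_lt_range' 1) hL
      subst hLeq
      rcases h₄ with rfl | hdec
      · left
        obtain rfl : s = 0 := by simpa using hR.length_eq.symm
        obtain rfl : k = r + 1 := by omega
        rw [range_succ (n := r + 1), range_eq_range']
      · rcases k with _ | _ | k
        · obtain rfl : s = r + 1 := by omega
          exact .inr (.inl ⟨R, (ih₁ _).2 ⟨by omega, hR, hR₁, hR₂, hR₃⟩, rfl⟩)
        · obtain rfl : s = r := by omega
          rcases s with _ | s
          · obtain rfl : R = [] := by simpa using hR
            exact .inl rfl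
          · exact .inr (.inr ⟨R, (ih₂ _).2 ⟨by omega, hR, hR₁, hR₂, hR₃⟩, rfl⟩)
        · simp [range'_succ] at hdec

theorem mem_avoiders132_2341_4213 (n : ℕ) (l : List ℕ) :
    l ∈ avoiders132_2341_4213 n ↔
      l ~ range n ∧ Avoids132 l ∧ Avoids2341 l ∧ Avoids4213 l := by
  induction n generalizing l with
  | zero =>
    simp only [avoiders132_2341_4213, Finset.mem_singleton, range_zero, perm_nil]
    constructor
    · rintro rfl
      exact ⟨rfl, .of_pairwise_lt .nil, .of_pairwise_lt .nil, .of_pairwise_gt .nil⟩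
    · exact And.left
  | succ n ih =>
    simp only [avoiders132_2341_4213, Finset.mem_union, Finset.mem_image, Finset.mem_biUnion,
      Finset.mem_range]
    constructor
    · rintro (⟨L, hL, rfl⟩ | ⟨r, hr, R, hR, rfl⟩)
      · obtain ⟨hp, h₁, h₂, h₃⟩ := (ih _).1 hL
        have hL : L ~ range' 0 n := by rwa [← range_eq_range']
        have hR : ([] : List ℕ) ~ range 0 := by simp
        obtain ⟨b₁, b₂, b₃, b₄⟩ := blocks_bounds hR hL
        rw [zero_add] at b₁ b₂
        refine ⟨by simpa using perm_range_append_cons hR hL,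
          (avoids132_append_cons_iff b₁ b₂ b₃).2 ⟨h₁, .of_pairwise_lt .nil⟩,
          (avoids2341_append_cons_iff b₁ b₂ b₃ b₄).2 ⟨h₂, .of_pairwise_lt .nil, .inl rfl⟩,
          (avoids4213_append_cons_iff b₁ b₂ b₃).2 ⟨h₃, .of_pairwise_lt .nil⟩⟩
      · obtain ⟨-, hp, h₁, h₂, h₃⟩ := (mem_avoiders132_213_2341 _ _).1 hR
        obtain ⟨k, rfl⟩ := Nat.exists_eq_add_of_le (Nat.lt_succ_iff.1 hr)
        rw [Nat.add_sub_cancel_left]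
        have hL := reverse_perm (range' r k)
        have hdec : (range' r k).reverse.Pairwise (· > ·) :=
          pairwise_reverse.2 (pairwise_lt_range' 1)
        obtain ⟨b₁, b₂, b₃, b₄⟩ := blocks_bounds hp hL
        exact ⟨perm_range_append_cons hp hL,
          (avoids132_append_cons_iff b₁ b₂ b₃).2 ⟨.of_pairwise_gt hdec, h₁⟩,
          (avoids2341_append_cons_iff b₁ b₂ b₃ b₄).2 ⟨.of_pairwise_gt hdec, h₃, .inr hdec⟩,
          (avoids4213_append_cons_iff b₁ b₂ b₃).2 ⟨.of_pairwise_gt hdec, h₂⟩⟩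
    · rintro ⟨hp, h₁, h₂, h₃⟩
      obtain ⟨L, R, r, k, rfl, hR, hL, rfl⟩ := exists_of_avoids132 hp h₁
      obtain ⟨b₁, b₂, b₃, b₄⟩ := blocks_bounds hR hL
      obtain ⟨h₁', h₁⟩ := (avoids132_append_cons_iff b₁ b₂ b₃).1 h₁
      obtain ⟨h₂', h₂, h₄⟩ := (avoids2341_append_cons_iff b₁ b₂ b₃ b₄).1 h₂
      obtain ⟨h₃', h₃⟩ := (avoids4213_append_cons_iff b₁ b₂ b₃).1 h₃
      rcases Nat.eq_zero_or_pos r with rfl | hr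
      · obtain rfl : R = [] := by simpa using hR
        refine .inl ⟨L, (ih _).2 ⟨?_, h₁', h₂', h₃'⟩, rfl⟩
        rwa [zero_add, range_eq_range']
      · have hdec : L.Pairwise (· > ·) := h₄.resolve_left fun h => by
          have := hR.length_eq
          simp [h] at this
          omega
        have hLeq : L = (range' r k).reverse := Perm.eq_of_pairwise (le := (· > ·))
          (fun a b _ _ h h' => absurd h h'.asymm) hdec
          (pairwise_reverse.2 (pairwise_lt_range' 1)) (hL.trans (reverse_perm _).symm)
        exact .inr ⟨r, by omega, R,
          (mem_avoiders132_213_2341 _ _).2 ⟨hr.ne', hR, h₁, h₃, h₂⟩, by simp [hLeq]⟩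

theorem card_avoiders132_213_2341 (n : ℕ) :
    (avoiders132_213_2341 n).card + 1 = Nat.fib (n + 2) := by
  induction n using avoiders132_213_2341.induct with
  | case1 => simp [avoiders132_213_2341]
  | case2 => simp [avoiders132_213_2341, Nat.fib_add_two]
  | case3 r ih₁ ih₂ =>
    rw [avoiders132_213_2341, Finset.card_insert_of_notMem, Finset.card_union_of_disjoint,
      Finset.card_image_of_injective _ (fun _ _ h => by simpa using h),
      Finset.card_image_of_injective _ (fun _ _ h => by simpa using h), Nat.fib_add_two, ← ih₁,
      ← ih₂]
    · ring
    · simp only [Finset.disjoint_left, Finset.mem_image]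
      rintro _ ⟨R, -, rfl⟩ ⟨R', -, h⟩
      simp at h
    · simp only [Finset.mem_union, Finset.mem_image, range_succ_eq_map, mem_avoiders132_213_2341]
      rintro (⟨R, -, h⟩ | ⟨R, hR, h⟩)
      · simp at h
      · exact hR.1 (by simp_all)

theorem card_avoiders132_2341_4213_succ (n : ℕ) :
    (avoiders132_2341_4213 (n + 1)).card =
      (avoiders132_2341_4213 n).card +
        ∑ r ∈ Finset.range (n + 1), (avoiders132_213_2341 r).card := by
  have hidx (r : ℕ) (hr : r < n + 1) (R : List ℕ) :
      idxOf n ((range' r (n - r)).reverse ++ n :: R) = n - r := by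
    rw [idxOf_append_of_notMem (by simp; omega)]
    simp
  rw [avoiders132_2341_4213, Finset.card_union_of_disjoint,
    Finset.card_image_of_injective _ (fun _ _ h => by simpa using h), Finset.card_biUnion]
  · congr 1
    exact Finset.sum_congr rfl fun r _ =>
      Finset.card_image_of_injective _ (fun _ _ h => by simpa using h)
  · intro r hr s hs hrs
    simp only [Finset.coe_range, Set.mem_Iio] at hr hs
    simp only [Function.onFun, Finset.disjoint_left, Finset.mem_image]
    rintro _ ⟨R, -, rfl⟩ ⟨R', -, h⟩
    have := congrArg (idxOf n) h
    rw [hidx r hr, hidx s hs] at this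
    omega
  · simp only [Finset.disjoint_left, Finset.mem_image, Finset.mem_biUnion, Finset.mem_range]
    rintro _ ⟨L, hL, rfl⟩ ⟨r, hr, R, hR, h⟩
    have hp := ((mem_avoiders132_2341_4213 _ _).1 hL).1
    have hlen : L.length = n := by simpa using hp.length_eq
    have hmem : n ∉ L := fun h => by simpa using hp.subset h
    have hr0 := ((mem_avoiders132_213_2341 _ _).1 hR).1
    have := congrArg (idxOf n) h
    rw [hidx r hr, idxOf_append_of_notMem hmem, hlen] at this
    simp at this
    omega

theorem sum_card_avoiders132_213_2341 (n : ℕ) :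
    ∑ r ∈ Finset.range n, (avoiders132_213_2341 r).card + n + 2 = Nat.fib (n + 3) := by
  induction n with
  | zero => simp [Nat.fib_add_two]
  | succ n ih =>
    rw [Finset.sum_range_succ, Nat.fib_add_two, ← card_avoiders132_213_2341,
      show n + 1 + 1 + 1 = n + 3 by ring, ← ih]
    ring

theorem card_avoiders132_2341_4213 (n : ℕ) :
    (avoiders132_2341_4213 n).card + (n + 1).choose 2 + 2 * (n + 1) + 2 = Nat.fib (n + 5) := by
  induction n with
  | zero => simp [avoiders132_2341_4213, Nat.fib_add_two]
  | succ n ih =>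
    have := sum_card_avoiders132_213_2341 (n + 1)
    have h₁ := Nat.fib_add_two (n := n + 4)
    have h₂ := Nat.choose_succ_succ (n + 1) 1
    rw [Nat.choose_one_right] at h₂
    rw [card_avoiders132_2341_4213_succ]
    simp only [Nat.succ_eq_add_one, Nat.reduceAdd, add_assoc] at *
    omega

end List

open List

section Word

variable {n : ℕ}

/-- The one-line notation of a permutation, as a list of natural numbers. -/
def Equiv.Perm.word (π : Equiv.Perm (Fin n)) : List ℕ := ofFn fun i => (π i : ℕ)

theorem pContains_iff_exists_sublist_word {k : ℕ} (π : Equiv.Perm (Fin n))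
    (σ : Equiv.Perm (Fin k)) :
    PContains π σ ↔
      ∃ h : Fin k → ℕ, ofFn h <+ π.word ∧ ∀ s t, h s < h t ↔ σ s < σ t := by
  constructor
  · rintro ⟨f, hf, h⟩
    refine ⟨fun s => π (f s), ?_, by simpa using h⟩
    refine sublist_iff_exists_fin_orderEmbedding_get_eq.2
      ⟨OrderEmbedding.ofStrictMono (fun i => Fin.cast (by simp [Equiv.Perm.word])
        (f (Fin.cast (by simp) i))) fun i j hij => ?_, ?_⟩
    · exact hf (by simpa using hij)
    · intro i
      simp [Equiv.Perm.word]
      rfl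
  · rintro ⟨h, hs, hσ⟩
    obtain ⟨f, hf⟩ := sublist_iff_exists_fin_orderEmbedding_get_eq.1 hs
    have hf' (s : Fin k) : h s =
        π (Fin.cast (by simp [Equiv.Perm.word]) (f (Fin.cast (by simp) s))) := by
      simpa [Equiv.Perm.word, Fin.cast] using hf (Fin.cast (by simp) s)
    refine ⟨fun s => Fin.cast (by simp [Equiv.Perm.word]) (f (Fin.cast (by simp) s)),
      fun s t hst => ?_, fun s t => ?_⟩
    · simpa using hst
    · rw [← hσ, hf', hf', Fin.val_fin_lt]

theorem pAvoids_p132_iff (π : Equiv.Perm (Fin n)) : PAvoids π p132 ↔ Avoids132 π.word := by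
  rw [PAvoids, pContains_iff_exists_sublist_word, not_exists]
  constructor
  · intro h a b c hs hlt
    refine h ![a, b, c] ⟨by simpa using hs, ?_⟩
    simp [Fin.forall_fin_succ, p132]
    omega
  · rintro h f ⟨hs, hσ⟩
    refine h (f 0) (f 1) (f 2) (by simpa [ofFn_succ] using hs) ?_
    simp [hσ, p132]

theorem pAvoids_p2341_iff (π : Equiv.Perm (Fin n)) : PAvoids π p2341 ↔ Avoids2341 π.word := by
  rw [PAvoids, pContains_iff_exists_sublist_word, not_exists]
  constructor
  · intro h a b c d hs hlt
    refine h ![a, b, c, d] ⟨by simpa using hs, ?_⟩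
    simp [Fin.forall_fin_succ, p2341]
    omega
  · rintro h f ⟨hs, hσ⟩
    refine h (f 0) (f 1) (f 2) (f 3) (by simpa [ofFn_succ] using hs) ?_
    simp [hσ, p2341]

theorem pAvoids_w4_iff (π : Equiv.Perm (Fin n)) : PAvoids π w4 ↔ Avoids4213 π.word := by
  rw [PAvoids, pContains_iff_exists_sublist_word, not_exists]
  constructor
  · intro h a b c d hs hlt
    refine h ![a, b, c, d] ⟨by simpa using hs, ?_⟩
    simp [Fin.forall_fin_succ, w4]
    omega
  · rintro h f ⟨hs, hσ⟩
    refine h (f 0) (f 1) (f 2) (f 3) (by simpa [ofFn_succ] using hs) ?_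
    simp [hσ, w4]

theorem Equiv.Perm.word_injective : Function.Injective (Equiv.Perm.word (n := n)) := by
  intro π τ h
  ext i
  exact congrFun (ofFn_injective h) i

theorem Equiv.Perm.exists_word_eq_iff (l : List ℕ) :
    (∃ π : Equiv.Perm (Fin n), π.word = l) ↔ l ~ range n := by
  constructor
  · rintro ⟨π, rfl⟩
    refine (perm_ext_iff_of_nodup ?_ nodup_range).2 fun a => ?_
    · exact nodup_ofFn.2 (Fin.val_injective.comp π.injective)
    · simp only [Equiv.Perm.word, mem_ofFn, mem_range]
      exact ⟨fun ⟨i, hi⟩ => hi ▸ (π i).2, fun ha => ⟨π.symm ⟨a, ha⟩, by simp⟩⟩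
  · intro h
    obtain rfl : l.length = n := by simpa using h.length_eq
    have hlt (i : Fin l.length) : l.get i < l.length := by simpa using h.subset (l.get_mem i)
    have hinj : Function.Injective fun i : Fin l.length => (⟨l.get i, hlt i⟩ : Fin l.length) :=
      fun i j hij => nodup_iff_injective_get.1 (h.nodup_iff.2 nodup_range) (Fin.mk.inj hij)
    exact ⟨Equiv.ofBijective _ (Finite.injective_iff_bijective.1 hinj), ofFn_get l⟩

end Word

theorem natCard_pAvoids_eq_card (n : ℕ) :
    Nat.card {π : Equiv.Perm (Fin n) // PAvoids π p132 ∧ PAvoids π p2341 ∧ PAvoids π w4} =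
      (avoiders132_2341_4213 n).card := by
  rw [← Nat.card_eq_finsetCard]
  refine Nat.card_eq_of_bijective (fun π => ⟨π.1.word, (mem_avoiders132_2341_4213 _ _).2
    ⟨(Equiv.Perm.exists_word_eq_iff _).1 ⟨π.1, rfl⟩, (pAvoids_p132_iff _).1 π.2.1,
      (pAvoids_p2341_iff _).1 π.2.2.1, (pAvoids_w4_iff _).1 π.2.2.2⟩⟩) ⟨fun π τ h => ?_, ?_⟩
  · exact Subtype.ext (Equiv.Perm.word_injective (congrArg Subtype.val h))
  · rintro ⟨l, hl⟩
    obtain ⟨hp, h₁, h₂, h₃⟩ := (mem_avoiders132_2341_4213 _ _).1 hl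
    obtain ⟨π, rfl⟩ := (Equiv.Perm.exists_word_eq_iff (n := n) l).2 hp
    exact ⟨⟨π, (pAvoids_p132_iff _).2 h₁, (pAvoids_p2341_iff _).2 h₂, (pAvoids_w4_iff _).2 h₃⟩, rfl⟩

/-- For `n ≥ 1`, `|S_n(132, 2341, ω_4)| = F_{n+5} - C(n+1,2) - 2 C(n+1,1) - 2`. -/
theorem statement12 (n : ℕ) (hn : 1 ≤ n) :
    (Nat.card {π : Equiv.Perm (Fin n) //
        PAvoids π p132 ∧ PAvoids π p2341 ∧ PAvoids π w4} : ℤ) =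
      Nat.fib (n + 5) - Nat.choose (n + 1) 2 - 2 * Nat.choose (n + 1) 1 - 2 := by
  rw [natCard_pAvoids_eq_card, ← card_avoiders132_2341_4213, Nat.choose_one_right]
  push_cast
  ring
end
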